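/- There exists an absolute constant C > 0 such that for every reduced rational α = v/w ∈ (0,1] and every real U ≥ 2, the count R_{1,α}(U) of quadruples (p,q,n,k) ∈ ℕ⁴ satisfying gcd(p,q) = 1, 2 ≤ p ≤ q ≤ U, 2 ≤ nq + kp ≤ U², 1 ≤ k < n, and inv_p(q) ≤ α·p, obeys | R_{1,α}(U) − (α log 2 /(2ζ(2)))·U⁴ log U | ≤ C·U⁴. -/

import Mathlib

/-- `inv_p(q)`: the least positive integer in the residue class `q⁻¹ (mod p)`. -/
def modInv (p q : ℕ) : ℕ := if ((q : ZMod p)⁻¹).val = 0 then p else ((q : ZMod p)⁻¹).val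

/-- The system of Case 1: `gcd(p,q) = 1`, `2 ≤ p ≤ q ≤ U`, `2 ≤ nq + kp ≤ U²`,
`1 ≤ k < n`, `inv_p(q) ≤ α·p`. -/
def Case1 (α : ℚ) (U : ℝ) (p q n k : ℕ) : Prop :=
  Nat.gcd p q = 1 ∧ 2 ≤ p ∧ p ≤ q ∧ (q : ℝ) ≤ U ∧
  2 ≤ n * q + k * p ∧ ((n * q + k * p : ℕ) : ℝ) ≤ U ^ 2 ∧
  1 ≤ k ∧ k < n ∧ (modInv p q : ℝ) ≤ (α : ℝ) * p

section Helpers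
open Finset


noncomputable def gkP (a : ℕ) (x : ℝ) : ℝ := (1 + x) / ((a + 1 + x) * (a + 2 + x))

noncomputable def gkU (φ : ℝ → ℝ) (x : ℝ) : ℝ := ∑' a : ℕ, φ (1 / (a + 1 + x)) * gkP a x

lemma gkP_nonneg (a : ℕ) {x : ℝ} (hx : 0 ≤ x) : 0 ≤ gkP a x := by
  unfold gkP; positivity

lemma gkP_sum (n : ℕ) {x : ℝ} (hx : 0 ≤ x) : ∑ a ∈ range n, gkP a x = 1 - (1 + x) / (n + 1 + x) := by
  induction n with
  | zero => simp; rw [div_self (by positivity)]; ring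
  | succ n ih =>
    rw [sum_range_succ, ih]; unfold gkP; push_cast
    have : (n + 1 + x) ≠ 0 := by positivity
    have : (n + 2 + x) ≠ 0 := by positivity
    have : (n + 1 + 1 + x) ≠ 0 := by positivity
    field_simp
    ring

lemma gkP_hasSum {x : ℝ} (hx : 0 ≤ x) : HasSum (fun a => gkP a x) 1 := by
  rw [hasSum_iff_tendsto_nat_of_nonneg (fun a => gkP_nonneg a hx)]
  simp_rw [gkP_sum _ hx]
  have h : Filter.Tendsto (fun n : ℕ => (1 + x) / ((n : ℝ) + 1 + x)) Filter.atTop (nhds 0) := by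
    apply Filter.Tendsto.div_atTop tendsto_const_nhds
    apply Filter.tendsto_atTop_add_const_right
    apply Filter.tendsto_atTop_add_const_right
    exact tendsto_natCast_atTop_atTop
  simpa using h.const_sub 1

lemma gk_arg (a : ℕ) {x : ℝ} (hx : 0 ≤ x) : 1 / ((a : ℝ) + 1 + x) ∈ Set.Icc (0 : ℝ) 1 := by
  refine ⟨by positivity, ?_⟩
  rw [div_le_one (by positivity)]
  have : (0 : ℝ) ≤ a := by positivity
  linarith

lemma gkU_summable {φ : ℝ → ℝ} {B : ℝ} (hB : ∀ z ∈ Set.Icc (0 : ℝ) 1, |φ z| ≤ B) {x : ℝ} (hx : 0 ≤ x) :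
    Summable (fun a : ℕ => φ (1 / (a + 1 + x)) * gkP a x) := by
  apply Summable.of_norm_bounded ((gkP_hasSum hx).summable.mul_left B)
  intro a
  rw [norm_mul, Real.norm_eq_abs, Real.norm_eq_abs, abs_of_nonneg (gkP_nonneg a hx)]
  exact mul_le_mul_of_nonneg_right (hB _ (gk_arg a hx)) (gkP_nonneg a hx)

/-- the class of monotone or antitone functions on the unit interval with values in `[m, M]` -/
lemma gkU_le {φ : ℝ → ℝ} {m M : ℝ} (h : ∀ z ∈ Set.Icc (0 : ℝ) 1, φ z ∈ Set.Icc m M) {x : ℝ} (hx : 0 ≤ x) :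
    gkU φ x ∈ Set.Icc m M := by
  have hs : Summable (fun a : ℕ => φ (1 / (a + 1 + x)) * gkP a x) := by
    apply gkU_summable (B := max |m| |M|) _ hx
    intro z hz
    exact abs_le_max_abs_abs (h z hz).1 (h z hz).2
  constructor
  · have := ((gkP_hasSum hx).summable.mul_left m).tsum_le_tsum (g := fun a : ℕ => φ (1 / (a + 1 + x)) * gkP a x) (fun a =>
      mul_le_mul_of_nonneg_right (h _ (gk_arg a hx)).1 (gkP_nonneg a hx)) hs
    rw [tsum_mul_left, (gkP_hasSum hx).tsum_eq, mul_one] at this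
    exact this
  · have := hs.tsum_le_tsum (g := fun a : ℕ => M * gkP a x) (fun a =>
      mul_le_mul_of_nonneg_right (h _ (gk_arg a hx)).2 (gkP_nonneg a hx)) ((gkP_hasSum hx).summable.mul_left M)
    rw [tsum_mul_left, (gkP_hasSum hx).tsum_eq, mul_one] at this
    exact this

lemma gkU_neg (φ : ℝ → ℝ) (x : ℝ) : gkU (fun z => - φ z) x = - gkU φ x := by
  unfold gkU
  rw [← tsum_neg]
  congr 1; ext a; ring

lemma gkU_sub {φ : ℝ → ℝ} {B : ℝ} (hB : ∀ z ∈ Set.Icc (0 : ℝ) 1, |φ z| ≤ B) (c : ℝ) {x : ℝ} (hx : 0 ≤ x) :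
    gkU (fun z => φ z - c) x = gkU φ x - c := by
  unfold gkU
  simp_rw [sub_mul]
  rw [(gkU_summable hB hx).tsum_sub ((gkP_hasSum hx).summable.mul_left c), tsum_mul_left, (gkP_hasSum hx).tsum_eq, mul_one]

lemma abel_nonneg (d c : ℕ → ℝ) (hc : Antitone c) (hD : ∀ n, 0 ≤ ∑ a ∈ range n, d a) (n : ℕ) :
    c n * ∑ a ∈ range n, d a ≤ ∑ a ∈ range n, d a * c a := by
  induction n with
  | zero => simp
  | succ n ih =>
    rw [sum_range_succ (fun a => d a * c a)]
    have h1 : c (n+1) ≤ c n := hc (Nat.le_succ n)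
    have h2 := mul_le_mul_of_nonneg_right h1 (hD (n+1))
    rw [sum_range_succ] at h2 ⊢
    linarith

lemma mono_bdd {φ : ℝ → ℝ} (h : MonotoneOn φ (Set.Icc 0 1)) : ∀ z ∈ Set.Icc (0 : ℝ) 1, φ z ∈ Set.Icc (φ 0) (φ 1) :=
  fun z hz => ⟨h (by simp) hz hz.1, h hz (by simp) hz.2⟩

lemma bdd_abs {φ : ℝ → ℝ} {m M : ℝ} (h : ∀ z ∈ Set.Icc (0 : ℝ) 1, φ z ∈ Set.Icc m M) :
    ∀ z ∈ Set.Icc (0 : ℝ) 1, |φ z| ≤ max |m| |M| :=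
  fun z hz => abs_le_max_abs_abs (h z hz).1 (h z hz).2

lemma gkU_antitone {φ : ℝ → ℝ} (h : MonotoneOn φ (Set.Icc 0 1)) : AntitoneOn (gkU φ) (Set.Icc 0 1) := by
  intro x hx y hy hxy
  have hB := bdd_abs (mono_bdd h)
  have s1 := gkU_summable hB hx.1
  have s2 := gkU_summable hB hy.1
  have s3 : Summable (fun a : ℕ => φ (1 / (a + 1 + y)) * gkP a x) := by
    apply Summable.of_norm_bounded ((gkP_hasSum hx.1).summable.mul_left (max |φ 0| |φ 1|))
    intro a
    rw [norm_mul, Real.norm_eq_abs, Real.norm_eq_abs, abs_of_nonneg (gkP_nonneg a hx.1)]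
    exact mul_le_mul_of_nonneg_right (hB _ (gk_arg a hy.1)) (gkP_nonneg a hx.1)
  have e1 : ∑' a : ℕ, φ (1 / (a + 1 + y)) * gkP a x ≤ gkU φ x := by
    apply s3.tsum_le_tsum _ s1
    intro a
    apply mul_le_mul_of_nonneg_right _ (gkP_nonneg a hx.1)
    apply h (gk_arg a hy.1) (gk_arg a hx.1)
    have : (0:ℝ) ≤ a := by positivity
    apply one_div_le_one_div_of_le <;> linarith [hx.1]
  refine le_trans ?_ e1
  rw [← sub_nonneg]
  unfold gkU
  rw [← s3.tsum_sub s2]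
  have hs := (s3.sub s2).hasSum.tendsto_sum_nat
  have hd := ((gkP_hasSum hx.1).sub (gkP_hasSum hy.1)).tendsto_sum_nat
  have hd2 := hd.const_mul (φ 0)
  rw [sub_self, mul_zero] at hd2
  refine le_of_tendsto_of_tendsto' hd2 hs ?_
  intro n
  have hDn : ∀ n, 0 ≤ ∑ a ∈ range n, (gkP a x - gkP a y) := by
    intro n
    rw [sum_sub_distrib, gkP_sum n hx.1, gkP_sum n hy.1]
    have : (1 + x) / (n + 1 + x) ≤ (1 + y) / (n + 1 + y) := by
      have := hx.1
      have := hy.1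
      rw [div_le_div_iff₀ (by positivity) (by positivity)]
      have : (0:ℝ) ≤ n := by positivity
      nlinarith
    linarith
  have ha := abel_nonneg (fun a => gkP a x - gkP a y) (fun a => φ (1 / (a + 1 + y))) ?_ hDn n
  · calc φ 0 * ∑ i ∈ range n, (gkP i x - gkP i y) ≤ _ := mul_le_mul_of_nonneg_right (mono_bdd h _ (gk_arg n hy.1)).1 (hDn n)
      _ ≤ _ := ha
      _ = _ := by apply sum_congr rfl; intros; ring
  · intro a b hab
    apply h (gk_arg b hy.1) (gk_arg a hy.1)
    have : (0:ℝ) ≤ a := by positivity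
    have : (a:ℝ) ≤ b := by exact_mod_cast hab
    apply one_div_le_one_div_of_le <;> linarith [hy.1]

lemma gkU_ends {φ : ℝ → ℝ} (h : MonotoneOn φ (Set.Icc 0 1)) : gkU φ 0 - gkU φ 1 ≤ (φ 1 - φ 0) / 2 := by
  have hB := bdd_abs (mono_bdd h)
  have h1 := (gkU_le (mono_bdd h) (zero_le_one' ℝ)).1
  have h2 : gkU φ 0 = φ 1 / 2 + gkU φ 1 / 2 := by
    conv_lhs => unfold gkU
    rw [(gkU_summable hB le_rfl).tsum_eq_zero_add]
    congr 1
    · simp [gkP]; ring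
    · unfold gkU
      rw [← tsum_div_const]
      congr 1; ext a
      unfold gkP
      push_cast
      have : (a + 2 : ℝ) ≠ 0 := by positivity
      have : (a + 3 : ℝ) ≠ 0 := by positivity
      have e : (1 / ((a:ℝ) + 1 + 1 + 0)) = 1 / (a + 1 + 1) := by ring
      rw [e]
      have e2 : (1 + (0:ℝ)) / ((a + 1 + 1 + 0) * (a + 1 + 2 + 0)) = (1 + 1) / ((a + 1 + 1) * (a + 2 + 1)) / 2 := by
        rw [show (a:ℝ) + 1 + 1 + 0 = a + 2 by ring, show (a:ℝ) + 1 + 2 + 0 = a + 3 by ring, show (a:ℝ) + 1 + 1 = a + 2 by ring, show (a:ℝ) + 2 + 1 = a + 3 by ring]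
        field_simp
        norm_num
      rw [e2]; ring
  linarith

/-- monotone or antitone on the unit interval, total variation at most `D` -/
def gkC (φ : ℝ → ℝ) (D : ℝ) : Prop :=
  (MonotoneOn φ (Set.Icc 0 1) ∧ φ 1 - φ 0 ≤ D) ∨ (AntitoneOn φ (Set.Icc 0 1) ∧ φ 0 - φ 1 ≤ D)

lemma gkC_range {φ : ℝ → ℝ} {D : ℝ} (h : gkC φ D) : ∃ m M, (∀ z ∈ Set.Icc (0 : ℝ) 1, φ z ∈ Set.Icc m M) ∧ M - m ≤ D
    ∧ gkC (gkU φ) (D / 2) := by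
  rcases h with ⟨h, hD⟩ | ⟨h, hD⟩
  · refine ⟨φ 0, φ 1, mono_bdd h, hD, Or.inr ⟨gkU_antitone h, ?_⟩⟩
    have := gkU_ends h
    linarith
  · have h' : MonotoneOn (fun z => - φ z) (Set.Icc 0 1) := h.neg
    have h1 := gkU_antitone h'
    have h2 := gkU_ends h'
    have e : gkU (fun z => - φ z) = fun x => - gkU φ x := by ext x; exact gkU_neg φ x
    rw [e] at h1 h2
    refine ⟨φ 1, φ 0, fun z hz => ⟨h hz (by simp) hz.2, h (by simp) hz hz.1⟩, hD, Or.inl ⟨?_, ?_⟩⟩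
    · intro x hx y hy hxy
      have := h1 hx hy hxy
      simp only [] at this
      linarith
    · simp only [] at h2
      linarith


def SS (ε : ℤ) (N : ℕ) : Finset (ℕ × ℕ × ℕ × ℕ) :=
  ((range (N+1)) ×ˢ (range (N+1)) ×ˢ (range (N+1)) ×ˢ (range (N+1))).filter fun v =>
    (v.1 * v.2.2.2 : ℤ) - v.2.1 * v.2.2.1 = ε ∧ 1 ≤ v.2.2.2 ∧ v.2.2.2 ≤ v.2.2.1 ∧ v.2.2.2 < v.2.1 ∧ v.2.1 ≤ v.1

lemma SS_rlt {ε : ℤ} (hε : ε = 1 ∨ ε = -1) {q p r x : ℕ} (h : (q * x : ℤ) - p * r = ε) (hx : 1 ≤ x)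
    (hxp : x < p) (hpq : p ≤ q) : r < q := by
  by_contra hc
  push Not at hc
  have h1 : (p * q : ℤ) ≤ p * r := by exact_mod_cast Nat.mul_le_mul_left p hc
  have h2 : (q * (x+1) : ℤ) ≤ q * p := by exact_mod_cast Nat.mul_le_mul_left q hxp
  have h3 : (2:ℤ) ≤ q := by exact_mod_cast (by omega : 2 ≤ q)
  rcases hε with rfl | rfl <;> nlinarith

lemma mem_SS {ε : ℤ} (hε : ε = 1 ∨ ε = -1) {N q p r x : ℕ} : (q, p, r, x) ∈ SS ε N ↔
    q ≤ N ∧ (q * x : ℤ) - p * r = ε ∧ 1 ≤ x ∧ x ≤ r ∧ x < p ∧ p ≤ q := by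
  simp only [SS, mem_filter, mem_product, mem_range]
  constructor
  · rintro ⟨⟨h1, h2, h3, h4⟩, h5, h6, h7, h8, h9⟩
    exact ⟨by omega, h5, h6, h7, h8, h9⟩
  · rintro ⟨h1, h5, h6, h7, h8, h9⟩
    have := SS_rlt hε h5 h6 h8 h9
    exact ⟨⟨by omega, by omega, by omega, by omega⟩, h5, h6, h7, h8, h9⟩

noncomputable def zt (t : ℝ) (v : ℕ × ℕ × ℕ × ℕ) : ℝ := (v.2.2.1 + v.2.2.2 * t) / (v.1 + v.2.1 * t)

noncomputable def GG (t : ℝ) (φ : ℝ → ℝ) (v : ℕ × ℕ × ℕ × ℕ) : ℝ :=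
  φ (zt t v) / (1 + zt t v) / (v.1 + v.2.1 * t) ^ 2

noncomputable def AA (ε : ℤ) (N : ℕ) (t : ℝ) (φ : ℝ → ℝ) : ℝ := ∑ v ∈ SS ε N, GG t φ v

lemma zt_mem {t : ℝ} (ht : t ∈ Set.Icc (0:ℝ) 1) {q p r x : ℕ} (h1 : r ≤ q) (h2 : x ≤ p) (h3 : 1 ≤ q) :
    zt t (q, p, r, x) ∈ Set.Icc (0:ℝ) 1 := by
  have := ht.1
  have hq : (1:ℝ) ≤ q := by exact_mod_cast h3
  have hr : (r:ℝ) ≤ q := by exact_mod_cast h1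
  have hx : (x:ℝ) ≤ p := by exact_mod_cast h2
  simp only [zt]
  refine ⟨by positivity, ?_⟩
  rw [div_le_one (by positivity)]
  nlinarith

lemma GG_abs {t : ℝ} (ht : t ∈ Set.Icc (0:ℝ) 1) {φ : ℝ → ℝ} {B : ℝ} (hB : ∀ z ∈ Set.Icc (0 : ℝ) 1, |φ z| ≤ B)
    {q p r x : ℕ} (h1 : r ≤ q) (h2 : x ≤ p) (h3 : 1 ≤ q) :
    |GG t φ (q, p, r, x)| ≤ B * (1 / (q:ℝ) ^ 2) := by
  have hz := zt_mem ht h1 h2 h3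
  have hq : (1:ℝ) ≤ q := by exact_mod_cast h3
  have ht0 := ht.1
  have hB0 : 0 ≤ B := (abs_nonneg _).trans (hB _ hz)
  simp only [GG]
  rw [abs_div, abs_div, abs_of_nonneg (show (0:ℝ) ≤ 1 + zt t (q,p,r,x) by linarith [hz.1]),
    abs_of_nonneg (show (0:ℝ) ≤ ((q:ℝ) + p * t)^2 by positivity), mul_one_div]
  have : |φ (zt t (q,p,r,x))| / (1 + zt t (q,p,r,x)) ≤ B := by
    refine le_trans (div_le_self (abs_nonneg _) (by linarith [hz.1])) (hB _ hz)
  apply div_le_div₀ hB0 this (by positivity)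
  apply pow_le_pow_left₀ (by positivity)
  have : 0 ≤ (p:ℝ) * t := by positivity
  linarith

lemma tail_bound {r s N : ℕ} (hr : 1 ≤ r) (hrN : r ≤ N) (n : ℕ) :
    ∑ a ∈ range n, (if (a+1) * r + s ≤ N then (0:ℝ) else 1 / (((a+1) * r + s : ℕ):ℝ)^2) ≤ 2 / (r * N) := by
  have hr' : (1:ℝ) ≤ r := by exact_mod_cast hr
  have hN' : (1:ℝ) ≤ N := by exact_mod_cast hr.trans hrN
  have hrN' : (r:ℝ) ≤ N := by exact_mod_cast hrN
  have hs : (0:ℝ) ≤ s := by positivity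
  let g : ℕ → ℝ := fun a => min (1 / (N:ℝ)) (1 / ((a+1) * r + s))
  have key : ∀ a, (if (a+1) * r + s ≤ N then (0:ℝ) else 1 / (((a+1) * r + s : ℕ):ℝ)^2) ≤ 2 / r * (g a - g (a+1)) := by
    intro a
    have hmono : g (a+1) ≤ g a := by
      apply min_le_min_left
      push_cast
      apply one_div_le_one_div_of_le (by positivity)
      linarith
    split_ifs with h
    · have : 0 ≤ g a - g (a+1) := by linarith
      positivity
    · push Not at h
      have h' : (N:ℝ) < (a+1) * r + s := by exact_mod_cast h
      have e1 : g a = 1 / ((a+1) * r + s) := by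
        apply min_eq_right
        apply one_div_le_one_div_of_le (by positivity) h'.le
      have e2 : g (a+1) ≤ 1 / ((a+1) * r + s + r) := by
        refine (min_le_right _ _).trans (le_of_eq ?_)
        push_cast; ring_nf
      have e3 : 2 / r * (g a - 1 / ((a+1) * r + s + r)) ≤ 2 / r * (g a - g (a+1)) := by
        apply mul_le_mul_of_nonneg_left _ (by positivity); linarith
      refine le_trans ?_ e3
      rw [e1]; push_cast
      set y : ℝ := (a+1) * r + s with hy
      have hy0 : 0 < y := by linarith
      have : 2 / (r:ℝ) * (1 / y - 1 / (y + r)) = 2 / (y * (y + r)) := by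
        field_simp; ring
      rw [this, div_le_div_iff₀ (by positivity) (by positivity)]
      nlinarith
  calc _ ≤ ∑ a ∈ range n, 2 / r * (g a - g (a+1)) := sum_le_sum fun a _ => key a
    _ = 2 / r * (g 0 - g n) := by rw [← mul_sum, sum_range_sub']
    _ ≤ 2 / r * (1 / N) := by
      apply mul_le_mul_of_nonneg_left _ (by positivity)
      have : g 0 ≤ 1 / N := min_le_left _ _
      have : 0 ≤ g n := le_min (by positivity) (by positivity)
      linarith
    _ = _ := by field_simp

lemma inv_sq_sum (n : ℕ) : ∑ a ∈ range n, 1 / ((a:ℝ) + 1)^2 ≤ 2 := by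
  have : ∑ a ∈ range n, 1 / ((a:ℝ) + 1)^2 ≤ 2 - 2 / ((n:ℝ) + 1) := by
    induction n with
    | zero => simp
    | succ n ih =>
      rw [sum_range_succ]
      have h1 : 2 / ((n:ℝ)+1) - 2 / (n+1+1) = 2 / ((n+1) * (n+1+1)) := by field_simp; ring
      have h2 : 1 / ((n:ℝ) + 1)^2 ≤ 2 / ((n+1) * (n+1+1)) := by
        rw [div_le_div_iff₀ (by positivity) (by positivity)]
        have : (0:ℝ) ≤ n := by positivity
        nlinarith
      push_cast
      linarith
  have h2 : (0:ℝ) ≤ 2 / ((n:ℝ) + 1) := by positivity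
  linarith

lemma inv_sq_sum' (n : ℕ) : ∑ a ∈ Icc 1 n, 1 / (a:ℝ)^2 ≤ 2 := by
  have := inv_sq_sum n
  have e : ∑ a ∈ Icc 1 n, 1 / (a:ℝ)^2 = ∑ a ∈ range n, 1 / ((a:ℝ) + 1)^2 := by
    rw [range_eq_Ico]
    have := sum_Ico_add' (fun a : ℕ => 1 / (a:ℝ)^2) 0 n 1
    push_cast at this
    rw [this]; rfl
  linarith

lemma child_eq {t : ℝ} (ht : t ∈ Set.Icc (0:ℝ) 1) (φ : ℝ → ℝ) {r x s u : ℕ} (hr : 1 ≤ r) (a : ℕ) :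
    GG t φ ((a+1) * r + s, (a+1) * x + u, r, x) =
      (φ (1 / (a + 1 + zt t (r, x, s, u))) * gkP a (zt t (r, x, s, u))) *
        (1 / (1 + zt t (r, x, s, u)) / (r + x * t) ^ 2) := by
  have ht0 := ht.1
  have hr' : (1:ℝ) ≤ r := by exact_mod_cast hr
  have hy : 0 < (r:ℝ) + x * t := by positivity
  have e1 : zt t ((a+1) * r + s, (a+1) * x + u, r, x) = 1 / (a + 1 + zt t (r, x, s, u)) := by
    simp only [zt]; push_cast
    rw [div_eq_div_iff (by positivity) (by positivity)]
    field_simp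
    ring
  have hz : 0 ≤ zt t (r, x, s, u) := by simp only [zt]; positivity
  have e2 : (((a+1) * r + s : ℕ) : ℝ) + ((a+1) * x + u : ℕ) * t = (r + x * t) * (a + 1 + zt t (r,x,s,u)) := by
    simp only [zt]; push_cast; field_simp; ring
  simp only [GG]
  rw [e1, e2]
  generalize zt t (r,x,s,u) = z at *
  generalize φ (1 / (a + 1 + z)) = f
  generalize (r:ℝ) + x * t = y at *
  unfold gkP
  have : (a:ℝ) + 1 + z ≠ 0 := by positivity
  have : (a:ℝ) + 2 + z ≠ 0 := by positivity
  have : 1 + z ≠ 0 := by positivity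
  have h3 : 1 + 1 / ((a:ℝ) + 1 + z) = (a + 2 + z) / (a + 1 + z) := by field_simp; ring
  rw [h3]
  field_simp

lemma inv_sq_prod (n m : ℕ) (T : Finset (ℕ × ℕ)) (hT : ∀ v ∈ T, 1 ≤ v.1 ∧ v.1 ≤ n ∧ 1 ≤ v.2 ∧ v.2 ≤ m) :
    ∑ v ∈ T, 1 / ((v.1:ℝ) * v.2)^2 ≤ 4 := by
  calc _ ≤ ∑ v ∈ Icc 1 n ×ˢ Icc 1 m, 1 / ((v.1:ℝ) * v.2)^2 := by
        apply sum_le_sum_of_subset_of_nonneg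
        · intro v hv
          have := hT v hv
          simp [mem_product]; omega
        · intros; positivity
    _ = (∑ a ∈ Icc 1 n, 1 / (a:ℝ)^2) * (∑ a ∈ Icc 1 m, 1 / (a:ℝ)^2) := by
        rw [sum_product, sum_mul_sum]
        apply sum_congr rfl; intros; apply sum_congr rfl; intros
        rw [mul_pow, one_div_mul_one_div]
    _ ≤ 2 * 2 := by
        apply mul_le_mul (inv_sq_sum' _) (inv_sq_sum' _) (sum_nonneg fun _ _ => by positivity) (by norm_num)
    _ = 4 := by norm_num

/-- the terms with `x = 1` -/
lemma x_one_sum {ε : ℤ} (hε : ε = 1 ∨ ε = -1) (N : ℕ) :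
    ∑ v ∈ (SS ε N).filter (fun v => ¬ 2 ≤ v.2.2.2), 1 / (v.1:ℝ)^2 ≤ 16 := by
  have h1 : ∀ v ∈ (SS ε N).filter (fun v => ¬ 2 ≤ v.2.2.2), 1 / (v.1:ℝ)^2 ≤ 4 * (1 / ((v.2.1:ℝ) * v.2.2.1)^2) := by
    rintro ⟨q, p, r, x⟩ hv
    rw [mem_filter, mem_SS hε] at hv
    obtain ⟨⟨h1, h2, h3, h4, h5, h6⟩, h7⟩ := hv
    simp only at *
    obtain rfl : x = 1 := by omega
    have hq : (p * r : ℤ) ≤ 2 * q := by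
      have : (2:ℤ) ≤ q := by exact_mod_cast (by omega : 2 ≤ q)
      rcases hε with rfl | rfl <;> push_cast at h2 <;> linarith
    have hq' : (p * r : ℝ) ≤ 2 * q := by exact_mod_cast hq
    have hp : (1:ℝ) ≤ p := by exact_mod_cast (by omega : 1 ≤ p)
    have hr : (1:ℝ) ≤ r := by exact_mod_cast (by omega : 1 ≤ r)
    have hqq : (1:ℝ) ≤ q := by exact_mod_cast (by omega : 1 ≤ q)
    rw [mul_one_div, div_le_div_iff₀ (by positivity) (by positivity)]
    have : ((p:ℝ) * r)^2 ≤ (2 * q)^2 := pow_le_pow_left₀ (by positivity) hq' 2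
    linarith
  calc _ ≤ _ := sum_le_sum h1
    _ = 4 * ∑ v ∈ (SS ε N).filter (fun v => ¬ 2 ≤ v.2.2.2), (1 / ((v.2.1:ℝ) * v.2.2.1)^2) := by rw [mul_sum]
    _ = 4 * ∑ v ∈ ((SS ε N).filter (fun v => ¬ 2 ≤ v.2.2.2)).image (fun v => ((v.2.1, v.2.2.1) : ℕ × ℕ)), 1 / ((v.1:ℝ) * v.2)^2 := by
        rw [sum_image]
        rintro ⟨q, p, r, x⟩ hv ⟨q', p', r', x'⟩ hv' he
        rw [mem_coe, mem_filter, mem_SS hε] at hv hv'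
        simp only [Prod.mk.injEq] at he hv hv' ⊢
        obtain ⟨rfl, rfl⟩ := he
        have hx : x = 1 := by omega
        have hx' : x' = 1 := by omega
        subst hx hx'
        have := hv.1.2.1
        have := hv'.1.2.1
        refine ⟨?_, rfl, rfl, rfl⟩
        push_cast at *
        lia
    _ ≤ 4 * 4 := by
        apply mul_le_mul_of_nonneg_left _ (by norm_num)
        apply inv_sq_prod N N
        intro v hv
        rw [mem_image] at hv
        obtain ⟨⟨q, p, r, x⟩, hv, rfl⟩ := hv
        rw [mem_filter, mem_SS hε] at hv
        have := SS_rlt hε hv.1.2.1 hv.1.2.2.1 hv.1.2.2.2.2.1 hv.1.2.2.2.2.2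
        simp only at *
        omega
    _ = 16 := by norm_num

lemma SS_inj {ε : ℤ} (hε : ε = 1 ∨ ε = -1) {N : ℕ} {v w : ℕ × ℕ × ℕ × ℕ} (hv : v ∈ SS ε N) (hw : w ∈ SS ε N)
    (h1 : v.1 = w.1) (h2 : v.2.1 = w.2.1) : v = w := by
  obtain ⟨q, p, r, x⟩ := v
  obtain ⟨q', p', r', x'⟩ := w
  simp only at h1 h2
  subst h1 h2
  rw [mem_SS hε] at hv hw
  obtain ⟨-, e1, a1, a2, a3, a4⟩ := hv
  obtain ⟨-, e2, b1, b2, b3, b4⟩ := hw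
  have hd : (p:ℤ) ∣ q * ((x:ℤ) - x') := ⟨r - r', by linear_combination e1 - e2⟩
  have hcop : IsCoprime (p:ℤ) q := by
    rcases hε with rfl | rfl
    · exact ⟨-r, x, by linear_combination e1⟩
    · exact ⟨r, -x, by linear_combination -e1⟩
  have hd2 : (p:ℤ) ∣ (x:ℤ) - x' := hcop.dvd_of_dvd_mul_left hd
  have hx : (x:ℤ) - x' = 0 := by
    apply Int.eq_zero_of_abs_lt_dvd hd2
    rw [abs_lt]; constructor <;> omega
  have hxx : x = x' := by omega
  subst hxx
  have : (p:ℤ) * ((r:ℤ) - r') = 0 := by linear_combination e2 - e1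
  rcases mul_eq_zero.1 this with h | h
  · omega
  · have : r = r' := by omega
    subst this; rfl

lemma sum_inv_first {ε : ℤ} (hε : ε = 1 ∨ ε = -1) (N : ℕ) : ∑ v ∈ SS ε N, 1 / (v.1:ℝ) ≤ N := by
  calc ∑ v ∈ SS ε N, 1 / (v.1:ℝ) = ∑ w ∈ (SS ε N).image (fun v => (⟨v.1, v.2.1⟩ : Sigma fun _ : ℕ => ℕ)), 1 / (w.1:ℝ) := by
        rw [sum_image]
        intro v hv w hw he
        simp only [Sigma.mk.injEq, heq_eq_eq] at he
        exact SS_inj hε hv hw he.1 he.2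
    _ ≤ ∑ w ∈ (Icc 1 N).sigma (fun q => Icc 1 q), 1 / (w.1:ℝ) := by
        apply sum_le_sum_of_subset_of_nonneg
        · intro v hv
          rw [mem_image] at hv
          obtain ⟨⟨q, p, r, x⟩, hv, rfl⟩ := hv
          rw [mem_SS hε] at hv
          simp only [mem_sigma, mem_Icc]
          omega
        · intros; positivity
    _ = ∑ q ∈ Icc 1 N, (1:ℝ) := by
        rw [sum_sigma]
        apply sum_congr rfl
        intro q hq
        rw [mem_Icc] at hq
        have : q ≠ 0 := by omega
        simp [this]
    _ = N := by simp

lemma children_sum {ε : ℤ} (hε : ε = 1 ∨ ε = -1) (N : ℕ) (F : ℕ × ℕ × ℕ × ℕ → ℝ) :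
    ∑ v ∈ SS (-ε) N, ∑ a ∈ (range N).filter (fun a => (a+1) * v.1 + v.2.2.1 ≤ N),
      F ((a+1) * v.1 + v.2.2.1, (a+1) * v.2.1 + v.2.2.2, v.1, v.2.1) =
    ∑ w ∈ (SS ε N).filter (fun v => 2 ≤ v.2.2.2), F w := by
  have hε' : -ε = 1 ∨ -ε = -1 := by rcases hε with rfl | rfl <;> simp
  rw [sum_sigma']
  refine sum_bij' (fun b _ => ((b.2+1) * b.1.1 + b.1.2.2.1, (b.2+1) * b.1.2.1 + b.1.2.2.2, b.1.1, b.1.2.1))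
    (fun w _ => ⟨(w.2.2.1, w.2.2.2, w.1 - (w.2.1 / w.2.2.2) * w.2.2.1, w.2.1 % w.2.2.2), w.2.1 / w.2.2.2 - 1⟩) ?_ ?_ ?_ ?_ ?_
  · rintro ⟨⟨r, x, s, u⟩, a⟩ hb
    rw [mem_sigma, mem_SS hε', mem_filter] at hb
    obtain ⟨⟨h1, h2, h3, h4, h5, h6⟩, h7, h8⟩ := hb
    rw [mem_filter, mem_SS hε]
    simp only at *
    refine ⟨⟨h8, ?_, by omega, h6, ?_, ?_⟩, by omega⟩
    · push_cast; linear_combination -h2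
    · nlinarith
    · nlinarith
  · rintro ⟨q, p, r, x⟩ hw
    rw [mem_filter, mem_SS hε] at hw
    obtain ⟨⟨h1, h2, h3, h4, h5, h6⟩, h7⟩ := hw
    simp only at h7
    have hdm := Nat.div_add_mod p x
    have hlt := Nat.mod_lt p (show 0 < x by omega)
    have ha : 1 ≤ p / x := (Nat.one_le_div_iff (by omega)).2 h5.le
    set a := p / x
    set u := p % x
    have hu : 1 ≤ u := by
      by_contra hc
      have : u = 0 := by omega
      rw [this, add_zero] at hdm
      have : (x:ℤ) ∣ ε := ⟨q - a * r, by rw [← h2, ← hdm]; push_cast; ring⟩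
      have : (x:ℤ) ∣ 1 := by rcases hε with rfl | rfl <;> simpa using this
      have := Int.le_of_dvd one_pos this
      omega
    have hrx : x < r := by
      rcases h4.lt_or_eq with h | h
      · exact h
      · exfalso
        subst h
        have : (x:ℤ) ∣ ε := ⟨q - p, by rw [← h2]; ring⟩
        have : (x:ℤ) ∣ 1 := by rcases hε with rfl | rfl <;> simpa using this
        have := Int.le_of_dvd one_pos this
        omega
    have hs : (x:ℤ) * ((q:ℤ) - a * r) = r * u + ε := by
      rw [← h2, ← hdm]; push_cast; ring
    have hus : (u:ℤ) ≤ (q:ℤ) - a * r := by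
      by_contra hc
      push Not at hc
      have h8 : (x:ℤ) * ((q:ℤ) - a * r) ≤ x * (u - 1) := mul_le_mul_of_nonneg_left (by omega) (by positivity)
      have h9 : ((x:ℤ)+1) * u ≤ r * u := mul_le_mul_of_nonneg_right (by omega) (by positivity)
      rcases hε with rfl | rfl <;> nlinarith
    have hq : a * r ≤ q := by zify; omega
    have hrq := SS_rlt hε h2 h3 h5 h6
    have hcast : ((q - a * r : ℕ) : ℤ) = (q:ℤ) - a * r := by push_cast [hq]; rfl
    rw [mem_sigma, mem_SS hε', mem_filter, mem_range]
    simp only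
    have ha1 : a - 1 + 1 = a := by omega
    rw [ha1]
    refine ⟨⟨by omega, ?_, hu, by omega, hlt, h4⟩, ?_, by omega⟩
    · rw [hcast]; linear_combination -hs
    · have : a ≤ a * r := Nat.le_mul_of_pos_right _ (by omega)
      omega
  · rintro ⟨⟨r, x, s, u⟩, a⟩ hb
    rw [mem_sigma, mem_SS hε', mem_filter] at hb
    obtain ⟨⟨h1, h2, h3, h4, h5, h6⟩, h7, h8⟩ := hb
    simp only at *
    have e1 : ((a+1) * x + u) / x = a + 1 := by
      rw [mul_comm, Nat.mul_add_div (by omega), Nat.div_eq_of_lt h5]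
    have e2 : ((a+1) * x + u) % x = u := by
      rw [mul_comm, Nat.mul_add_mod, Nat.mod_eq_of_lt h5]
    rw [e1, e2]
    simp
  · rintro ⟨q, p, r, x⟩ hw
    rw [mem_filter, mem_SS hε] at hw
    obtain ⟨⟨h1, h2, h3, h4, h5, h6⟩, h7⟩ := hw
    simp only at *
    have hdm := Nat.div_add_mod p x
    have ha : 1 ≤ p / x := (Nat.one_le_div_iff (by omega)).2 h5.le
    have ha1 : p / x - 1 + 1 = p / x := by omega
    rw [ha1]
    have hq : p / x * r ≤ q := by
      have : x * (p / x) * r ≤ x * q := by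
        have h8 : x * (p/x) * r ≤ p * r := Nat.mul_le_mul_right _ (by omega)
        rcases hε with rfl | rfl
        · zify at h8 ⊢; linarith
        · by_contra hc
          push Not at hc
          have h9 : x * q + 1 = p * r := by zify; linarith
          have h10 : x * (p/x) * r = x * q + 1 := by omega
          have : x ∣ 1 := (Nat.dvd_add_right (Dvd.intro _ rfl : x ∣ x * q)).1 (h10 ▸ ⟨p / x * r, by ring⟩)
          have := Nat.le_of_dvd one_pos this
          omega
      rw [mul_assoc] at this
      exact Nat.le_of_mul_le_mul_left this (by omega)
    simp only [Prod.mk.injEq, and_true]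
    refine ⟨by omega, by rw [mul_comm]; exact hdm⟩
  · rintro ⟨⟨r, x, s, u⟩, a⟩ hb
    rfl

lemma GG_child_sum {t : ℝ} (ht : t ∈ Set.Icc (0:ℝ) 1) {φ : ℝ → ℝ} {B : ℝ} (hB : ∀ z ∈ Set.Icc (0 : ℝ) 1, |φ z| ≤ B)
    {N r x s u : ℕ} (hr : 1 ≤ r) (hrN : r ≤ N) (hxr : x ≤ r) (hux : u ≤ x) (hus : u ≤ s) (hsr : s ≤ r) :
    |GG t (gkU φ) (r, x, s, u) - ∑ a ∈ (range N).filter (fun a => (a+1) * r + s ≤ N),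
      GG t φ ((a+1) * r + s, (a+1) * x + u, r, x)| ≤ B * (2 / (r * N)) := by
  have hz := zt_mem (t := t) ht hsr hux hr
  have hB0 : 0 ≤ B := (abs_nonneg _).trans (hB _ hz)
  set f : ℕ → ℝ := fun a => GG t φ ((a+1) * r + s, (a+1) * x + u, r, x) with hf
  have hfe : f = fun a : ℕ => (φ (1 / (a + 1 + zt t (r, x, s, u))) * gkP a (zt t (r, x, s, u))) *
        (1 / (1 + zt t (r, x, s, u)) / (r + x * t) ^ 2) := by
    ext a; exact child_eq ht φ hr a
  have hfs : Summable f := by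
    rw [hfe]; exact (gkU_summable hB hz.1).mul_right _
  have hG : GG t (gkU φ) (r, x, s, u) = ∑' a, f a := by
    rw [hfe, tsum_mul_right]; simp only [GG, gkU]; ring
  have hfin : ∑ a ∈ (range N).filter (fun a => (a+1) * r + s ≤ N), f a = ∑' a, (if (a+1) * r + s ≤ N then f a else 0) := by
    rw [tsum_eq_sum (s := range N), sum_filter]
    intro a ha
    rw [mem_range] at ha
    rw [if_neg]
    have : a + 1 ≤ (a+1) * r := Nat.le_mul_of_pos_right _ hr
    omega
  have hs1 : Summable (fun a => (if (a+1) * r + s ≤ N then f a else 0)) := by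
    apply summable_of_ne_finset_zero (s := range N)
    intro a ha
    rw [mem_range] at ha
    rw [if_neg]
    have : a + 1 ≤ (a+1) * r := Nat.le_mul_of_pos_right _ hr
    omega
  rw [hG, hfin, ← hfs.tsum_sub hs1]
  set g : ℕ → ℝ := fun a => (if (a+1) * r + s ≤ N then (0:ℝ) else 1 / (((a+1) * r + s : ℕ):ℝ)^2) with hg
  have hg0 : ∀ a, 0 ≤ g a := by intro a; simp only [hg]; split_ifs <;> positivity
  have hgs : Summable g := summable_of_sum_range_le hg0 (fun n => tail_bound (s := s) hr hrN n)
  have hgt : ∑' a, g a ≤ 2 / (r * N) := hgs.tsum_le_of_sum_range_le (fun n => tail_bound (s := s) hr hrN n)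
  have hle : ∀ a, ‖f a - (if (a+1) * r + s ≤ N then f a else 0)‖ ≤ B * g a := by
    intro a
    simp only [hg]
    split_ifs
    · simp
    · rw [sub_zero, Real.norm_eq_abs]
      apply GG_abs ht hB
      · nlinarith
      · nlinarith
      · nlinarith
  have := tsum_of_norm_bounded (hgs.mul_left B).hasSum hle
  rw [tsum_mul_left, Real.norm_eq_abs] at this
  exact this.trans (mul_le_mul_of_nonneg_left hgt hB0)

lemma step {ε : ℤ} (hε : ε = 1 ∨ ε = -1) (N : ℕ) {t : ℝ} (ht : t ∈ Set.Icc (0:ℝ) 1) {φ : ℝ → ℝ} {B : ℝ}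
    (hB : ∀ z ∈ Set.Icc (0 : ℝ) 1, |φ z| ≤ B) :
    |AA ε N t φ - AA (-ε) N t (gkU φ)| ≤ 18 * B := by
  have hε' : -ε = 1 ∨ -ε = -1 := by rcases hε with rfl | rfl <;> simp
  have hB0 : 0 ≤ B := (abs_nonneg _).trans (hB 0 (by simp))
  have h1 : AA ε N t φ = ∑ v ∈ (SS ε N).filter (fun v => 2 ≤ v.2.2.2), GG t φ v
      + ∑ v ∈ (SS ε N).filter (fun v => ¬ 2 ≤ v.2.2.2), GG t φ v := by
    rw [sum_filter_add_sum_filter_not]; rfl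
  rw [h1, ← children_sum hε]
  have h2 : |∑ v ∈ (SS ε N).filter (fun v => ¬ 2 ≤ v.2.2.2), GG t φ v| ≤ B * 16 := by
    refine (abs_sum_le_sum_abs _ _).trans ?_
    refine le_trans ?_ (mul_le_mul_of_nonneg_left (x_one_sum hε N) hB0)
    rw [mul_sum]
    apply sum_le_sum
    rintro ⟨q, p, r, x⟩ hv
    rw [mem_filter, mem_SS hε] at hv
    have := SS_rlt hε hv.1.2.1 hv.1.2.2.1 hv.1.2.2.2.2.1 hv.1.2.2.2.2.2
    apply GG_abs ht hB <;> omega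
  have h3 : |AA (-ε) N t (gkU φ) - ∑ v ∈ SS (-ε) N, ∑ a ∈ (range N).filter (fun a => (a+1) * v.1 + v.2.2.1 ≤ N),
      GG t φ ((a+1) * v.1 + v.2.2.1, (a+1) * v.2.1 + v.2.2.2, v.1, v.2.1)| ≤ B * 2 := by
    unfold AA
    rw [← sum_sub_distrib]
    refine (abs_sum_le_sum_abs _ _).trans ?_
    calc _ ≤ ∑ v ∈ SS (-ε) N, B * (2 / N) * (1 / (v.1:ℝ)) := by
          apply sum_le_sum
          rintro ⟨r, x, s, u⟩ hv
          rw [mem_SS hε'] at hv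
          obtain ⟨h1, h2, h3, h4, h5, h6⟩ := hv
          have := SS_rlt hε' h2 h3 h5 h6
          have := GG_child_sum (N := N) (r := r) (x := x) (s := s) (u := u) ht hB (by omega) h1 h6 h5.le h4 this.le
          refine this.trans (le_of_eq ?_)
          simp only
          rw [mul_assoc, div_mul_div_comm, mul_one, mul_comm (N:ℝ)]
      _ = B * (2 / N) * ∑ v ∈ SS (-ε) N, (1 / (v.1:ℝ)) := by rw [mul_sum]
      _ ≤ B * (2 / N) * N := mul_le_mul_of_nonneg_left (sum_inv_first hε' N) (by positivity)
      _ ≤ B * 2 := by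
        rw [mul_assoc]
        apply mul_le_mul_of_nonneg_left _ hB0
        rcases Nat.eq_zero_or_pos N with h0 | h0
        · simp [h0]
        · have : (N:ℝ) ≠ 0 := by positivity
          rw [div_mul_cancel₀ _ this]
  rw [abs_le] at *
  constructor <;> linarith [h2.1, h2.2, h3.1, h3.2]

lemma AA_abs {ε : ℤ} (hε : ε = 1 ∨ ε = -1) (N : ℕ) {t : ℝ} (ht : t ∈ Set.Icc (0:ℝ) 1) {φ : ℝ → ℝ} {B : ℝ}
    (hB : ∀ z ∈ Set.Icc (0 : ℝ) 1, |φ z| ≤ B) : |AA ε N t φ| ≤ B * N := by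
  have hB0 : 0 ≤ B := (abs_nonneg _).trans (hB 0 (by simp))
  refine (abs_sum_le_sum_abs _ _).trans ?_
  refine le_trans ?_ (mul_le_mul_of_nonneg_left (sum_inv_first hε N) hB0)
  rw [mul_sum]
  apply sum_le_sum
  rintro ⟨q, p, r, x⟩ hv
  rw [mem_SS hε] at hv
  have := SS_rlt hε hv.2.1 hv.2.2.1 hv.2.2.2.2.1 hv.2.2.2.2.2
  refine (GG_abs ht hB (by omega) (by omega) (by omega)).trans ?_
  apply mul_le_mul_of_nonneg_left _ hB0
  have : (1:ℝ) ≤ q := by exact_mod_cast (by omega : 1 ≤ q)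
  apply one_div_le_one_div_of_le (by positivity)
  simp only
  nlinarith

lemma iter_bound (N : ℕ) (k : ℕ) : ∀ (ε : ℤ) (_ : ε = 1 ∨ ε = -1) (φ : ℝ → ℝ) (D : ℝ) (_ : gkC φ D),
    ∃ c : ℝ, (∀ m M, (∀ z ∈ Set.Icc (0 : ℝ) 1, φ z ∈ Set.Icc m M) → c ∈ Set.Icc m M) ∧
      ∀ t ∈ Set.Icc (0:ℝ) 1, |AA ε N t (fun z => φ z - c)| ≤ 36 * D + D / 2 ^ k * N := by
  induction k with
  | zero =>
    intro ε hε φ D hφ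
    obtain ⟨m, M, h1, h2, h3⟩ := gkC_range hφ
    refine ⟨φ 0, fun m M h => h 0 (by simp), fun t ht => ?_⟩
    have hD : 0 ≤ D := by
      have := h1 0 (by simp)
      linarith [this.1, this.2]
    have := AA_abs hε N ht (φ := fun z => φ z - φ 0) (B := D) (by
      intro z hz
      have a := h1 z hz
      have b := h1 0 (by simp)
      rw [abs_le]; constructor <;> linarith [a.1, a.2, b.1, b.2])
    simp only [pow_zero, div_one]
    linarith
  | succ k ih =>
    intro ε hε φ D hφ
    have hε' : -ε = 1 ∨ -ε = -1 := by rcases hε with rfl | rfl <;> simp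
    obtain ⟨m, M, h1, h2, h3⟩ := gkC_range hφ
    obtain ⟨c, hc1, hc2⟩ := ih (-ε) hε' _ _ h3
    have hc3 : ∀ m M, (∀ z ∈ Set.Icc (0 : ℝ) 1, φ z ∈ Set.Icc m M) → c ∈ Set.Icc m M := by
      intro m M h
      exact hc1 m M (fun z hz => gkU_le h hz.1)
    refine ⟨c, hc3, fun t ht => ?_⟩
    have hcm := hc3 m M h1
    have hst := step hε N ht (φ := fun z => φ z - c) (B := D) (by
      intro z hz
      have a := h1 z hz
      rw [abs_le]; constructor <;> linarith [a.1, a.2, hcm.1, hcm.2])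
    have he : AA (-ε) N t (gkU fun z => φ z - c) = AA (-ε) N t (fun z => gkU φ z - c) := by
      apply sum_congr rfl
      rintro ⟨q, p, r, x⟩ hv
      rw [mem_SS hε'] at hv
      have := SS_rlt hε' hv.2.1 hv.2.2.1 hv.2.2.2.2.1 hv.2.2.2.2.2
      have hz := zt_mem (t := t) ht this.le hv.2.2.2.2.1.le (by omega)
      simp only [GG]
      rw [gkU_sub (bdd_abs h1) c hz.1]
    rw [he] at hst
    have := hc2 t ht
    have e : D / 2 / 2 ^ k * (N:ℝ) = D / 2 ^ (k+1) * N := by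
      rw [div_div, pow_succ']
    rw [e] at this
    rw [abs_le] at *
    constructor <;> linarith [hst.1, hst.2, this.1, this.2]

lemma limit_bound (N : ℕ) {ε : ℤ} (hε : ε = 1 ∨ ε = -1) {φ : ℝ → ℝ} {D : ℝ} (hφ : gkC φ D) :
    ∃ c : ℝ, ∀ t ∈ Set.Icc (0:ℝ) 1, |AA ε N t φ - c * AA ε N t (fun _ => 1)| ≤ 37 * D := by
  obtain ⟨c, -, hc⟩ := iter_bound N N ε hε φ D hφ
  obtain ⟨m, M, h1, h2, h3⟩ := gkC_range hφ
  have hD : 0 ≤ D := by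
    have := h1 0 (by simp)
    linarith [this.1, this.2]
  refine ⟨c, fun t ht => ?_⟩
  have e : AA ε N t (fun z => φ z - c) = AA ε N t φ - c * AA ε N t (fun _ => 1) := by
    unfold AA
    rw [mul_sum, ← sum_sub_distrib]
    apply sum_congr rfl
    intro v _
    simp only [GG]; ring
  rw [← e]
  refine (hc t ht).trans ?_
  have : D / 2 ^ N * (N:ℝ) ≤ D := by
    rw [div_mul_eq_mul_div]
    apply div_le_of_le_mul₀ (by positivity) hD
    apply mul_le_mul_of_nonneg_left _ hD
    exact_mod_cast Nat.lt_two_pow_self.le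
  linarith

lemma coprime_ind (n : ℕ) (hn : n ≠ 0) : (if n = 1 then (1:ℝ) else 0) = ∑ d ∈ n.divisors, (ArithmeticFunction.moebius d : ℝ) := by
  have h := ArithmeticFunction.moebius_mul_coe_zeta
  have h2 := congrArg (fun f => f n) h
  simp only [ArithmeticFunction.coe_mul_zeta_apply, ArithmeticFunction.one_apply] at h2
  have h3 : ((∑ d ∈ n.divisors, ArithmeticFunction.moebius d : ℤ) : ℝ) = ((if n = 1 then 1 else 0 : ℤ) : ℝ) := by rw [h2]
  push_cast at h3
  exact h3.symm

lemma mob_sum (N : ℕ) (w : ℕ → ℕ → ℝ) :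
    ∑ q ∈ Icc 1 N, ∑ p ∈ Icc 1 q, (if Nat.gcd p q = 1 then w q p else 0) =
    ∑ d ∈ Icc 1 N, (ArithmeticFunction.moebius d : ℝ) * ∑ q ∈ Icc 1 (N / d), ∑ p ∈ Icc 1 q, w (d * q) (d * p) := by
  have h1 : ∑ q ∈ Icc 1 N, ∑ p ∈ Icc 1 q, (if Nat.gcd p q = 1 then w q p else 0) =
      ∑ q ∈ Icc 1 N, ∑ p ∈ Icc 1 q, ∑ d ∈ (Nat.gcd p q).divisors, (ArithmeticFunction.moebius d : ℝ) * w q p := by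
    apply sum_congr rfl; intro q hq
    apply sum_congr rfl; intro p hp
    rw [mem_Icc] at hp
    rw [← sum_mul, ← coprime_ind _ (Nat.gcd_pos_of_pos_left _ hp.1).ne']
    split_ifs <;> simp
  rw [h1]
  simp_rw [mul_sum]
  simp_rw [sum_sigma']
  refine sum_bij' (fun b _ => ⟨b.2.2, ⟨b.1 / b.2.2, b.2.1 / b.2.2⟩⟩) (fun c _ => ⟨c.1 * c.2.1, ⟨c.1 * c.2.2, c.1⟩⟩) ?_ ?_ ?_ ?_ ?_
  · rintro ⟨q, p, d⟩ h
    simp only [mem_sigma, mem_Icc, Nat.mem_divisors] at h ⊢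
    obtain ⟨⟨h1, h2⟩, ⟨h3, h4⟩, h5, h6⟩ := h
    have hp : d ∣ p := h5.trans (Nat.gcd_dvd_left _ _)
    have hq : d ∣ q := h5.trans (Nat.gcd_dvd_right _ _)
    have hd : 0 < d := Nat.pos_of_dvd_of_pos hp h3
    have hdq := Nat.le_of_dvd h1 hq
    have hdp := Nat.le_of_dvd h3 hp
    exact ⟨⟨hd, by omega⟩, ⟨(Nat.one_le_div_iff hd).2 hdq, Nat.div_le_div_right h2⟩, (Nat.one_le_div_iff hd).2 hdp, Nat.div_le_div_right h4⟩
  · rintro ⟨d, q, p⟩ h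
    simp only [mem_sigma, mem_Icc, Nat.mem_divisors] at h ⊢
    obtain ⟨⟨h1, h2⟩, ⟨h3, h4⟩, h5, h6⟩ := h
    have h7 : d * q ≤ N := by
      rw [mul_comm]; exact (Nat.le_div_iff_mul_le h1).1 h4
    refine ⟨⟨Nat.mul_pos h1 h3, h7⟩, ⟨Nat.mul_pos h1 h5, Nat.mul_le_mul_left _ h6⟩, Nat.dvd_gcd (Dvd.intro _ rfl) (Dvd.intro _ rfl), ?_⟩
    exact (Nat.gcd_pos_of_pos_left _ (Nat.mul_pos h1 h5)).ne'
  · rintro ⟨q, p, d⟩ h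
    simp only [mem_sigma, mem_Icc, Nat.mem_divisors] at h ⊢
    obtain ⟨⟨h1, h2⟩, ⟨h3, h4⟩, h5, h6⟩ := h
    have hp : d ∣ p := h5.trans (Nat.gcd_dvd_left _ _)
    have hq : d ∣ q := h5.trans (Nat.gcd_dvd_right _ _)
    rw [Nat.mul_div_cancel' hp, Nat.mul_div_cancel' hq]
  · rintro ⟨d, q, p⟩ h
    simp only [mem_sigma, mem_Icc] at h ⊢
    have hd : 0 < d := by omega
    rw [Nat.mul_div_cancel_left _ hd, Nat.mul_div_cancel_left _ hd]
  · rintro ⟨q, p, d⟩ h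
    simp only [mem_sigma, mem_Icc, Nat.mem_divisors] at h ⊢
    obtain ⟨⟨h1, h2⟩, ⟨h3, h4⟩, h5, h6⟩ := h
    have hp : d ∣ p := h5.trans (Nat.gcd_dvd_left _ _)
    have hq : d ∣ q := h5.trans (Nat.gcd_dvd_right _ _)
    rw [Nat.mul_div_cancel' hp, Nat.mul_div_cancel' hq]

lemma mu_abs (d : ℕ) : |(ArithmeticFunction.moebius d : ℝ)| ≤ 1 := by
  exact_mod_cast ArithmeticFunction.abs_moebius_le_one (n := d)

lemma frac_count {α : ℝ} (h0 : 0 ≤ α) (h1 : α ≤ 1) (q : ℕ) :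
    |∑ r ∈ Icc 1 q, ((if α * q < r then (1:ℝ) else 0) - (1 - α))| ≤ 1 := by
  have hfl : ⌊α * q⌋₊ ≤ q := by
    apply Nat.floor_le_of_le
    have : (0:ℝ) ≤ q := by positivity
    nlinarith
  have h2 : ∑ r ∈ Icc 1 q, (if α * q < r then (1:ℝ) else 0) = q - ⌊α * q⌋₊ := by
    rw [sum_boole]
    have : (Icc 1 q).filter (fun r : ℕ => α * q < r) = Ioc ⌊α * q⌋₊ q := by
      ext r
      simp only [mem_filter, mem_Icc, mem_Ioc]
      rw [Nat.floor_lt (by positivity)]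
      constructor
      · rintro ⟨⟨a, b⟩, c⟩; exact ⟨c, b⟩
      · rintro ⟨a, b⟩
        refine ⟨⟨?_, b⟩, a⟩
        have := (Nat.floor_lt (by positivity)).2 a
        omega
    rw [this, Nat.card_Ioc, Nat.cast_sub hfl]
  rw [sum_sub_distrib, h2]
  simp only [sum_const, Nat.card_Icc, Nat.add_sub_cancel, nsmul_eq_mul]
  have a1 := Nat.floor_le (show 0 ≤ α * q by positivity)
  have a2 := Nat.lt_floor_add_one (α * q)
  rw [abs_le]; constructor <;> linarith

lemma frac_sum {α : ℝ} (h0 : 0 ≤ α) (h1 : α ≤ 1) (N : ℕ) :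
    |∑ q ∈ Icc 1 N, ∑ r ∈ Icc 1 q, (if Nat.gcd r q = 1 then
      ((if α * q < r then (1:ℝ) else 0) - (1 - α)) / (q:ℝ)^2 else 0)| ≤ 4 := by
  have := mob_sum N (fun q r => ((if α * q < r then (1:ℝ) else 0) - (1 - α)) / (q:ℝ)^2)
  rw [this]
  refine (abs_sum_le_sum_abs _ _).trans ?_
  calc _ ≤ ∑ d ∈ Icc 1 N, 2 * (1 / (d:ℝ)^2) := ?_
    _ = 2 * ∑ d ∈ Icc 1 N, (1 / (d:ℝ)^2) := by rw [mul_sum]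
    _ ≤ 2 * 2 := by linarith [inv_sq_sum' N]
    _ = 4 := by norm_num
  apply sum_le_sum
  intro d hd
  rw [mem_Icc] at hd
  have hd' : (1:ℝ) ≤ d := by exact_mod_cast hd.1
  rw [abs_mul]
  refine (mul_le_of_le_one_left (abs_nonneg _) (mu_abs d)).trans ?_
  refine (abs_sum_le_sum_abs _ _).trans ?_
  calc _ ≤ ∑ q ∈ Icc 1 (N / d), 1 / (d:ℝ)^2 * (1 / (q:ℝ)^2) := ?_
    _ = 1 / (d:ℝ)^2 * ∑ q ∈ Icc 1 (N / d), (1 / (q:ℝ)^2) := by rw [mul_sum]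
    _ ≤ 1 / (d:ℝ)^2 * 2 := mul_le_mul_of_nonneg_left (inv_sq_sum' _) (by positivity)
    _ = _ := by ring
  apply sum_le_sum
  intro q hq
  rw [← sum_div, abs_div]
  have e : ∀ p : ℕ, (α * ((d * q : ℕ):ℝ) < ((d * p : ℕ) : ℝ)) ↔ α * q < p := by
    intro p
    push_cast
    rw [show α * ((d:ℝ) * q) = d * (α * q) by ring]
    exact mul_lt_mul_iff_right₀ (by linarith)
  simp_rw [e]
  rw [abs_of_nonneg (show (0:ℝ) ≤ ((d * q : ℕ) : ℝ)^2 by positivity)]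
  push_cast
  rw [one_div_mul_one_div, ← mul_pow]
  exact div_le_div_of_nonneg_right (frac_count h0 h1 q) (by positivity)

lemma mu_tsum : Summable (fun d : ℕ => (ArithmeticFunction.moebius d : ℝ) / (d:ℝ)^2) ∧
    ∑' d : ℕ, (ArithmeticFunction.moebius d : ℝ) / (d:ℝ)^2 = 1 / (Real.pi^2 / 6) := by
  have hs : (1:ℝ) < (2:ℂ).re := by norm_num
  have h1 := ArithmeticFunction.LSeriesSummable_moebius_iff.2 hs
  have h2 := ArithmeticFunction.LSeries_zeta_mul_Lseries_moebius hs
  rw [ArithmeticFunction.LSeries_zeta_eq_riemannZeta hs, riemannZeta_two] at h2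
  have e : LSeries.term (fun n => ((ArithmeticFunction.moebius n : ℤ) : ℂ)) 2 = fun d : ℕ => (((ArithmeticFunction.moebius d : ℝ) / (d:ℝ)^2 : ℝ) : ℂ) := by
    ext d
    rw [LSeries.term_def]
    split_ifs with h
    · simp [h]
    · push_cast
      norm_cast
  unfold LSeriesSummable at h1
  rw [e] at h1
  unfold LSeries at h2
  rw [e, ← Complex.ofReal_tsum] at h2
  refine ⟨Complex.summable_ofReal.1 h1, ?_⟩
  have h3 : (Real.pi ^ 2 / 6) * ∑' d : ℕ, (ArithmeticFunction.moebius d : ℝ) / (d:ℝ)^2 = 1 := by exact_mod_cast h2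
  rw [eq_div_iff (by positivity), mul_comm]
  exact h3

lemma log_summable : Summable (fun d : ℕ => Real.log d / (d:ℝ)^2) := by
  have h := (Real.summable_nat_rpow_inv (p := 3/2)).2 (by norm_num)
  apply Summable.of_nonneg_of_le _ _ (h.mul_left 2)
  · intro d
    have := Real.log_natCast_nonneg d
    positivity
  · intro d
    rcases Nat.eq_zero_or_pos d with rfl | hd
    · simp
    have hd' : (0:ℝ) < d := by exact_mod_cast hd
    have h1 := Real.log_le_rpow_div hd'.le (show (0:ℝ) < 1/2 by norm_num)
    rw [div_le_iff₀ (by positivity)]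
    have h2 : ((d:ℝ) ^ (3/2:ℝ))⁻¹ * (d:ℝ)^2 = (d:ℝ)^(1/2:ℝ) := by
      rw [← Real.rpow_neg hd'.le, ← Real.rpow_natCast, ← Real.rpow_add hd']
      norm_num
    rw [mul_assoc, h2]
    linarith

lemma half_sum (q j : ℕ) (hq : 1 ≤ q) : Real.log (q + j + 1) - Real.log (q + 1) ≤ ∑ p ∈ Icc 1 j, 1 / ((p:ℝ) + q) ∧
    ∑ p ∈ Icc 1 j, 1 / ((p:ℝ) + q) ≤ Real.log (q + j) - Real.log q := by
  have hq' : (1:ℝ) ≤ q := by exact_mod_cast hq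
  have key : ∀ y : ℝ, 1 ≤ y → 1 / (y+1) ≤ Real.log (y+1) - Real.log y ∧ Real.log (y+1) - Real.log y ≤ 1 / y := by
    intro y hy
    rw [← Real.log_div (by positivity) (by positivity)]
    constructor
    · have := Real.one_sub_inv_le_log_of_pos (show 0 < (y+1)/y by positivity)
      refine le_trans (le_of_eq ?_) this
      field_simp; ring
    · have := Real.log_le_sub_one_of_pos (show 0 < (y+1)/y by positivity)
      refine le_trans this (le_of_eq ?_)
      field_simp; ring
  induction j with
  | zero => simp
  | succ j ih =>
    rw [sum_Icc_succ_top (by omega)]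
    push_cast
    have hj : (0:ℝ) ≤ j := by positivity
    have k1 := (key (q + j) (by linarith)).1
    have k2 := (key (q + j + 1) (by linarith)).2
    rw [show (q:ℝ) + (j+1) + 1 = q + j + 1 + 1 by ring, show (q:ℝ) + (j+1) = q + j + 1 by ring, show (j:ℝ) + 1 + q = q + j + 1 by ring]
    constructor <;> linarith [ih.1, ih.2]

lemma half_sum' (q : ℕ) (hq : 1 ≤ q) : |∑ p ∈ Icc 1 q, 1 / ((p:ℝ) + q) - Real.log 2| ≤ 1 / q := by
  have hq' : (1:ℝ) ≤ q := by exact_mod_cast hq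
  obtain ⟨h1, h2⟩ := half_sum q q hq
  have e1 : Real.log (q + q) - Real.log q = Real.log 2 := by
    rw [← Real.log_div (by positivity) (by positivity)]; congr 1; field_simp; ring
  have e2 : Real.log 2 - 1 / q ≤ Real.log (q + q + 1) - Real.log (q + 1) := by
    rw [← Real.log_div (by positivity) (by positivity)]
    have : Real.log 2 - Real.log ((q+q+1)/(q+1)) ≤ 1 / q := by
      rw [← Real.log_div (by positivity) (by positivity)]
      refine (Real.log_le_sub_one_of_pos (by positivity)).trans ?_
      rw [div_div_eq_mul_div, div_sub_one (by positivity), div_le_div_iff₀ (by positivity) (by positivity)]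
      nlinarith
    linarith
  have : 0 ≤ 1 / (q:ℝ) := by positivity
  rw [abs_le]; constructor <;> linarith

lemma harm (n : ℕ) (hn : 1 ≤ n) : |∑ q ∈ Icc 1 n, 1 / (q:ℝ) - Real.log n| ≤ 1 := by
  have h1 := log_add_one_le_harmonic n
  have h2 := harmonic_le_one_add_log n
  have e : ((harmonic n : ℚ) : ℝ) = ∑ q ∈ Icc 1 n, 1 / (q:ℝ) := by
    rw [harmonic_eq_sum_Icc]; push_cast; simp
  rw [e] at h1 h2
  have hn' : (1:ℝ) ≤ n := by exact_mod_cast hn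
  have : Real.log n ≤ Real.log ↑(n+1) := by
    apply Real.log_le_log (by linarith); push_cast; linarith
  rw [abs_le]; constructor <;> linarith

lemma FF (n : ℕ) (hn : 1 ≤ n) :
    |∑ q ∈ Icc 1 n, ∑ p ∈ Icc 1 q, 1 / ((q:ℝ) * (p + q)) - Real.log 2 * Real.log n| ≤ 3 := by
  have l2 : Real.log 2 ≤ 1 := by linarith [Real.log_two_lt_d9]
  have l20 : 0 ≤ Real.log 2 := by linarith [Real.log_two_gt_d9]
  have h1 : |∑ q ∈ Icc 1 n, ∑ p ∈ Icc 1 q, 1 / ((q:ℝ) * (p + q)) - Real.log 2 * ∑ q ∈ Icc 1 n, 1 / (q:ℝ)| ≤ 2 := by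
    rw [mul_sum, ← sum_sub_distrib]
    refine (abs_sum_le_sum_abs _ _).trans ?_
    refine le_trans ?_ (inv_sq_sum' n)
    apply sum_le_sum
    intro q hq
    rw [mem_Icc] at hq
    have hq' : (1:ℝ) ≤ q := by exact_mod_cast hq.1
    have e : ∑ p ∈ Icc 1 q, 1 / ((q:ℝ) * (p + q)) - Real.log 2 * (1 / q) = (1 / q) * (∑ p ∈ Icc 1 q, 1 / ((p:ℝ) + q) - Real.log 2) := by
      rw [mul_sub, mul_sum]
      congr 1
      · apply sum_congr rfl; intros; rw [one_div_mul_one_div]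
      · ring
    rw [e, abs_mul, abs_of_nonneg (by positivity : 0 ≤ 1 / (q:ℝ))]
    calc _ ≤ 1 / (q:ℝ) * (1 / q) := mul_le_mul_of_nonneg_left (half_sum' q hq.1) (by positivity)
      _ = _ := by rw [one_div_mul_one_div, sq]
  have h2 : |Real.log 2 * ∑ q ∈ Icc 1 n, 1 / (q:ℝ) - Real.log 2 * Real.log n| ≤ 1 := by
    rw [← mul_sub, abs_mul, abs_of_nonneg l20]
    have := harm n hn
    have := abs_nonneg (∑ q ∈ Icc 1 n, 1 / (q:ℝ) - Real.log n)
    nlinarith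
  rw [abs_le] at *
  constructor <;> linarith [h1.1, h1.2, h2.1, h2.2]

lemma log_floor {N d : ℕ} (hd : 1 ≤ d) (hN : d ≤ N) : |Real.log ((N / d : ℕ) : ℝ) - (Real.log N - Real.log d)| ≤ 1 := by
  have hd' : (1:ℝ) ≤ d := by exact_mod_cast hd
  have hN' : (d:ℝ) ≤ N := by exact_mod_cast hN
  have h1 : 1 ≤ N / d := (Nat.one_le_div_iff hd).2 hN
  have h1' : (1:ℝ) ≤ ((N / d : ℕ) : ℝ) := by exact_mod_cast h1
  have hup : ((N / d : ℕ) : ℝ) ≤ N / d := Nat.cast_div_le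
  have hlow : (N:ℝ) / d ≤ 2 * ((N / d : ℕ) : ℝ) := by
    rw [div_le_iff₀ (by linarith)]
    have : N ≤ 2 * (N / d) * d := by
      have := Nat.div_add_mod N d
      have := Nat.mod_lt N hd
      nlinarith
    exact_mod_cast this
  rw [← Real.log_div (by linarith) (by linarith)]
  have a1 := Real.log_le_log (by linarith) hup
  have a2 := Real.log_le_log (by apply div_pos <;> linarith) hlow
  rw [Real.log_mul (by norm_num) (by linarith)] at a2
  have l2 : Real.log 2 ≤ 1 := by linarith [Real.log_two_lt_d9]
  rw [abs_le]; constructor <;> linarith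

lemma coprime_sum : ∃ C : ℝ, 0 < C ∧ ∀ N : ℕ, 1 ≤ N →
    |∑ q ∈ Icc 1 N, ∑ p ∈ Icc 1 q, (if Nat.gcd p q = 1 then 1 / ((q:ℝ) * (p + q)) else 0)
      - Real.log 2 / (Real.pi^2 / 6) * Real.log N| ≤ C := by
  have l2 : Real.log 2 ≤ 1 := by linarith [Real.log_two_lt_d9]
  have l20 : 0 ≤ Real.log 2 := by linarith [Real.log_two_gt_d9]
  set M := ∑' d : ℕ, Real.log d / (d:ℝ)^2 with hM
  have hM0 : 0 ≤ M := tsum_nonneg fun d => by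
    have := Real.log_natCast_nonneg d
    positivity
  refine ⟨8 + M, by linarith, fun N hN => ?_⟩
  rw [mob_sum N (fun q p => 1 / ((q:ℝ) * (p + q)))]
  have h1 : |∑ d ∈ Icc 1 N, (ArithmeticFunction.moebius d : ℝ) * ∑ q ∈ Icc 1 (N / d), ∑ p ∈ Icc 1 q, 1 / (((d * q : ℕ):ℝ) * (((d * p : ℕ):ℝ) + ((d * q : ℕ):ℝ)))
      - ∑ d ∈ Icc 1 N, Real.log 2 * ((ArithmeticFunction.moebius d : ℝ) / (d:ℝ)^2 * (Real.log N - Real.log d))| ≤ 8 := by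
    rw [← sum_sub_distrib]
    refine (abs_sum_le_sum_abs _ _).trans ?_
    calc _ ≤ ∑ d ∈ Icc 1 N, 4 * (1 / (d:ℝ)^2) := ?_
      _ = 4 * ∑ d ∈ Icc 1 N, (1 / (d:ℝ)^2) := by rw [mul_sum]
      _ ≤ 4 * 2 := by linarith [inv_sq_sum' N]
      _ = 8 := by norm_num
    apply sum_le_sum
    intro d hd
    rw [mem_Icc] at hd
    have hd' : (1:ℝ) ≤ d := by exact_mod_cast hd.1
    have e : ∑ q ∈ Icc 1 (N / d), ∑ p ∈ Icc 1 q, 1 / (((d * q : ℕ):ℝ) * (((d * p : ℕ):ℝ) + ((d * q : ℕ):ℝ))) =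
        1 / (d:ℝ)^2 * ∑ q ∈ Icc 1 (N / d), ∑ p ∈ Icc 1 q, 1 / ((q:ℝ) * (p + q)) := by
      simp_rw [mul_sum]
      apply sum_congr rfl; intro q _
      apply sum_congr rfl; intro p _
      rw [one_div_mul_one_div]; push_cast; ring_nf
    rw [e]
    have hF := FF (N / d) ((Nat.one_le_div_iff hd.1).2 hd.2)
    have hl := log_floor hd.1 hd.2
    set S := ∑ q ∈ Icc 1 (N / d), ∑ p ∈ Icc 1 q, 1 / ((q:ℝ) * (p + q))
    have h4 : |S - Real.log 2 * (Real.log N - Real.log d)| ≤ 4 := by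
      rw [abs_le] at *
      constructor <;> nlinarith
    have e2 : (ArithmeticFunction.moebius d : ℝ) * (1 / (d:ℝ)^2 * S) - Real.log 2 * ((ArithmeticFunction.moebius d : ℝ) / (d:ℝ)^2 * (Real.log N - Real.log d))
      = (ArithmeticFunction.moebius d : ℝ) * ((1 / (d:ℝ)^2) * (S - Real.log 2 * (Real.log N - Real.log d))) := by ring
    rw [e2, abs_mul]
    refine (mul_le_of_le_one_left (abs_nonneg _) (mu_abs d)).trans ?_
    rw [abs_mul, abs_of_nonneg (by positivity : 0 ≤ 1 / (d:ℝ)^2), mul_comm]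
    exact mul_le_mul_of_nonneg_right h4 (by positivity)
  have h2 : |∑ d ∈ Icc 1 N, (ArithmeticFunction.moebius d : ℝ) / (d:ℝ)^2 * (Real.log N - Real.log d) - 1 / (Real.pi^2 / 6) * Real.log N| ≤ M := by
    rw [← mu_tsum.2, ← tsum_mul_right]
    have e : ∑ d ∈ Icc 1 N, (ArithmeticFunction.moebius d : ℝ) / (d:ℝ)^2 * (Real.log N - Real.log d) =
      ∑' d, (if d ∈ Icc 1 N then (ArithmeticFunction.moebius d : ℝ) / (d:ℝ)^2 * (Real.log N - Real.log d) else 0) := by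
      rw [tsum_eq_sum (s := Icc 1 N)]
      · apply sum_congr rfl; intro d hd; rw [if_pos hd]
      · intro d hd; rw [if_neg hd]
    have hs : Summable fun d => (if d ∈ Icc 1 N then (ArithmeticFunction.moebius d : ℝ) / (d:ℝ)^2 * (Real.log N - Real.log d) else 0) := by
      apply summable_of_ne_finset_zero (s := Icc 1 N)
      intro d hd; rw [if_neg hd]
    rw [e, ← hs.tsum_sub (mu_tsum.1.mul_right _), ← Real.norm_eq_abs]
    apply tsum_of_norm_bounded log_summable.hasSum
    intro d
    rw [Real.norm_eq_abs]
    have hld := Real.log_natCast_nonneg d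
    have hlN := Real.log_natCast_nonneg N
    have base : ∀ y : ℝ, |y| ≤ Real.log d → |(ArithmeticFunction.moebius d : ℝ) / (d:ℝ)^2 * y| ≤ Real.log d / (d:ℝ)^2 := by
      intro y hy
      rw [div_mul_eq_mul_div, abs_div, abs_of_nonneg (by positivity : 0 ≤ (d:ℝ)^2), abs_mul]
      apply div_le_div_of_nonneg_right _ (by positivity)
      exact (mul_le_of_le_one_left (abs_nonneg _) (mu_abs d)).trans hy
    split_ifs with h
    · have := base (- Real.log d) (by rw [abs_neg, abs_of_nonneg hld])
      rw [← mul_sub]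
      convert this using 3; ring
    · rw [zero_sub, abs_neg]
      rcases Nat.eq_zero_or_pos d with rfl | hd
      · simp
      apply base
      rw [abs_of_nonneg hlN]
      apply Real.log_le_log (by exact_mod_cast hN)
      rw [mem_Icc] at h
      exact_mod_cast (by omega : N ≤ d)
  have h3 : |∑ d ∈ Icc 1 N, Real.log 2 * ((ArithmeticFunction.moebius d : ℝ) / (d:ℝ)^2 * (Real.log N - Real.log d)) - Real.log 2 / (Real.pi^2 / 6) * Real.log N| ≤ M := by
    rw [← mul_sum]
    rw [show Real.log 2 / (Real.pi^2 / 6) * Real.log N = Real.log 2 * (1 / (Real.pi^2 / 6) * Real.log N) by ring, ← mul_sub, abs_mul, abs_of_nonneg l20]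
    exact (mul_le_of_le_one_left (abs_nonneg _) l2).trans h2
  rw [abs_le] at *
  constructor <;> linarith [h1.1, h1.2, h3.1, h3.2]

lemma exists_of_coprime_r {q r : ℕ} (hr : 1 ≤ r) (hrq : r + 2 ≤ q) (hc : Nat.gcd r q = 1) :
    ∃ p x : ℕ, (q * x : ℤ) - p * r = 1 ∧ 1 ≤ x ∧ x ≤ r ∧ x < p ∧ p ≤ q := by
  obtain ⟨m, hm, hm1⟩ := Nat.exists_mul_mod_eq_one_of_coprime (n := r) (k := q) hc (by omega)
  have h1 := Nat.div_add_mod (r * m) q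
  rw [hm1] at h1
  generalize r * m / q = j at h1
  have hjr : j < r := by
    have : q * j < q * r := by nlinarith
    exact lt_of_mul_lt_mul_left this (Nat.zero_le _)
  obtain ⟨p, hp⟩ : ∃ p, q = m + p := ⟨q - m, by omega⟩
  obtain ⟨x, hx⟩ : ∃ x, r = j + x := ⟨r - j, by omega⟩
  have e : (q * x : ℤ) - p * r = 1 := by
    have a1 : (x:ℤ) = r - j := by rw [hx]; push_cast; ring
    have a2 : (p:ℤ) = q - m := by rw [hp]; push_cast; ring
    have a3 : (q:ℤ) * j + 1 = r * m := by exact_mod_cast h1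
    rw [a1, a2]; linear_combination -a3
  refine ⟨p, x, e, by omega, by omega, ?_, by omega⟩
  by_contra hlt
  push Not at hlt
  have b1 : (p:ℤ) ≤ x := by exact_mod_cast hlt
  have b2 : (r:ℤ) + 2 ≤ q := by exact_mod_cast hrq
  have b3 : (1:ℤ) ≤ x := by have : 1 ≤ x := by omega
                            exact_mod_cast this
  nlinarith

lemma SS_inj_r {N : ℕ} {v w : ℕ × ℕ × ℕ × ℕ} (hv : v ∈ SS 1 N) (hw : w ∈ SS 1 N)
    (h1 : v.1 = w.1) (h2 : v.2.2.1 = w.2.2.1) : v = w := by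
  obtain ⟨q, p, r, x⟩ := v
  obtain ⟨q', p', r', x'⟩ := w
  simp only at h1 h2
  subst h1 h2
  have a := (mem_SS (Or.inl rfl)).1 hv
  have b := (mem_SS (Or.inl rfl)).1 hw
  obtain ⟨-, a1, a2, a3, a4, a5⟩ := a
  obtain ⟨-, b1, b2, b3, b4, b5⟩ := b
  have hc : IsCoprime (q:ℤ) (r:ℤ) := ⟨x, -p, by linarith⟩
  have hd : (q:ℤ) ∣ (p:ℤ) - p' := by
    apply hc.dvd_of_dvd_mul_right
    exact ⟨(x:ℤ) - x', by linarith⟩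
  have hp : p = p' := by
    have := Int.eq_zero_of_abs_lt_dvd hd (by rw [abs_lt]; constructor <;> omega)
    omega
  subst hp
  have hq : (q:ℤ) ≠ 0 := by omega
  have : (x:ℤ) = x' := mul_left_cancel₀ hq (by linarith)
  have : x = x' := by exact_mod_cast this
  rw [this]

lemma E0_bound {α : ℝ} (h0 : 0 ≤ α) (h1 : α ≤ 1) (N : ℕ) :
    |∑ v ∈ SS 1 N, ((if α * v.1 < v.2.2.1 then (1:ℝ) else 0) - (1-α)) / (v.1:ℝ)^2| ≤ 6 := by
  classical
  have hf := frac_sum h0 h1 N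
  rw [Finset.sum_sigma', ← Finset.sum_filter] at hf
  set T := ((Icc 1 N).sigma (fun q => Icc 1 q)).filter (fun w => Nat.gcd w.2 w.1 = 1) with hT
  set g : (Σ _ : ℕ, ℕ) → ℝ := fun w => ((if α*w.1<w.2 then (1:ℝ) else 0)-(1-α))/(w.1:ℝ)^2 with hg
  change |∑ w ∈ T, g w| ≤ 4 at hf
  let e : ℕ × ℕ × ℕ × ℕ → (Σ _ : ℕ, ℕ) := fun v => ⟨v.1, v.2.2.1⟩
  have hS : ∑ v ∈ SS 1 N, ((if α * v.1 < v.2.2.1 then (1:ℝ) else 0) - (1-α)) / (v.1:ℝ)^2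
      = ∑ w ∈ (SS 1 N).image e, g w := by
    rw [Finset.sum_image]
    intro v hv w hw h
    simp only [e, Sigma.mk.injEq, heq_eq_eq] at h
    exact SS_inj_r hv hw h.1 h.2
  have hsub : (SS 1 N).image e ⊆ T := by
    intro w hw
    obtain ⟨⟨q, p, r, x⟩, hv, rfl⟩ := Finset.mem_image.1 hw
    obtain ⟨a0, a1, a2, a3, a4, a5⟩ := (mem_SS (Or.inl rfl)).1 hv
    have hr := SS_rlt (Or.inl rfl) a1 a2 a4 a5
    have hc : IsCoprime (r:ℤ) (q:ℤ) := ⟨-p, x, by linarith⟩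
    simp only [hT, e, Finset.mem_filter, Finset.mem_sigma, Finset.mem_Icc]
    exact ⟨⟨by omega, by omega⟩, Nat.isCoprime_iff_coprime.1 hc⟩
  have hsd := Finset.sum_sdiff (f := g) hsub
  have hrest : |∑ w ∈ T \ (SS 1 N).image e, g w| ≤ 2 := by
    have key : ∀ w ∈ T \ (SS 1 N).image e, 1 ≤ w.1 ∧ w.1 ≤ N ∧ w.2 = (if w.1 = 1 then 1 else w.1 - 1) := by
      rintro ⟨q, r⟩ hw
      rw [Finset.mem_sdiff] at hw
      obtain ⟨hw1, hw2⟩ := hw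
      simp only [hT, Finset.mem_filter, Finset.mem_sigma, Finset.mem_Icc] at hw1
      obtain ⟨⟨⟨c1, c2⟩, c3, c4⟩, c5⟩ := hw1
      refine ⟨c1, c2, ?_⟩
      by_contra hne
      have hr2 : r + 2 ≤ q := by
        by_contra hh
        split_ifs at hne with hq
        · simp only at hq hne; omega
        · simp only at hq hne
          have : r = q := by omega
          subst this
          rw [Nat.gcd_self] at c5
          omega
      obtain ⟨p, x, d1, d2, d3, d4, d5⟩ := exists_of_coprime_r c3 hr2 c5
      exact hw2 (Finset.mem_image.2 ⟨(q,p,r,x), (mem_SS (Or.inl rfl)).2 ⟨c2, d1, d2, d3, d4, d5⟩, rfl⟩)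
    calc |∑ w ∈ T \ (SS 1 N).image e, g w| ≤ ∑ w ∈ T \ (SS 1 N).image e, |g w| := Finset.abs_sum_le_sum_abs _ _
      _ ≤ ∑ w ∈ T \ (SS 1 N).image e, 1 / (w.1:ℝ)^2 := by
          apply Finset.sum_le_sum
          intro w hw
          rw [hg, abs_div, abs_of_nonneg (sq_nonneg (w.1:ℝ))]
          apply div_le_div_of_nonneg_right _ (sq_nonneg _)
          rw [abs_le]; split_ifs <;> constructor <;> linarith
      _ = ∑ a ∈ (T \ (SS 1 N).image e).image (fun w => (w.1:ℕ)), 1 / ((a:ℕ):ℝ)^2 := by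
          rw [Finset.sum_image]
          intro v hv w hw h
          have k1 := (key v hv).2.2
          have k2 := (key w hw).2.2
          simp only at h
          rw [h, ← k2] at k1
          exact Sigma.ext h (heq_of_eq k1)
      _ ≤ ∑ a ∈ Icc 1 N, 1 / (a:ℝ)^2 := by
          apply Finset.sum_le_sum_of_subset_of_nonneg
          · intro a ha
            obtain ⟨w, hw, rfl⟩ := Finset.mem_image.1 ha
            have := key w hw
            exact Finset.mem_Icc.2 ⟨this.1, this.2.1⟩
          · intros; positivity
      _ ≤ 2 := inv_sq_sum' N
  rw [hS]
  rw [abs_le] at *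
  constructor <;> linarith [hrest.1, hrest.2, hf.1, hf.2]

lemma SS_facts {N : ℕ} {q p r x : ℕ} (hv : (q,p,r,x) ∈ SS 1 N) :
    (1:ℝ) ≤ q ∧ (1:ℝ) ≤ p ∧ (1:ℝ) ≤ x ∧ (1:ℝ) ≤ r ∧ (x:ℝ) ≤ p ∧ (r:ℝ) ≤ q ∧ (p:ℝ) ≤ q ∧ (q:ℝ) * x - p * r = 1 := by
  obtain ⟨a0, a1, a2, a3, a4, a5⟩ := (mem_SS (Or.inl rfl)).1 hv
  have hr := SS_rlt (Or.inl rfl) a1 a2 a4 a5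
  refine ⟨?_, ?_, ?_, ?_, ?_, ?_, ?_, ?_⟩
  on_goal 8 => exact_mod_cast a1
  all_goals norm_cast
  all_goals omega

lemma gkC1 : gkC (fun x => 1 + x) 1 := by
  left
  refine ⟨fun a _ b _ h => by simp only; linarith, by norm_num⟩

lemma gkC2 (α : ℝ) : gkC (fun x => if α < x then 1 + x else 0) 2 := by
  left
  refine ⟨fun a ha b hb h => ?_, ?_⟩
  · simp only
    have := ha.1
    have := hb.1
    split_ifs <;> linarith
  · simp only
    split_ifs <;> norm_num

lemma Et_bound {α : ℝ} (h0 : 0 ≤ α) (h1 : α ≤ 1) (N : ℕ) {t : ℝ} (ht : t ∈ Set.Icc (0:ℝ) 1) :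
    |∑ v ∈ SS 1 N, ((if α < zt t v then (1:ℝ) else 0) - (1-α)) / ((v.1:ℝ) + v.2.1 * t)^2| ≤ 345 := by
  obtain ⟨c1, hc1⟩ := limit_bound N (Or.inl rfl : (1:ℤ) = 1 ∨ (1:ℤ) = -1) gkC1
  obtain ⟨c2, hc2⟩ := limit_bound N (Or.inl rfl : (1:ℤ) = 1 ∨ (1:ℤ) = -1) (gkC2 α)
  have hE : ∀ t ∈ Set.Icc (0:ℝ) 1,
      ∑ v ∈ SS 1 N, ((if α < zt t v then (1:ℝ) else 0) - (1-α)) / ((v.1:ℝ) + v.2.1 * t)^2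
      = AA 1 N t (fun x => if α < x then 1 + x else 0) - (1-α) * AA 1 N t (fun x => 1 + x) := by
    intro t ht
    rw [AA, AA, Finset.mul_sum, ← Finset.sum_sub_distrib]
    apply Finset.sum_congr rfl
    rintro ⟨q, p, r, x⟩ hv
    obtain ⟨a0, a1, a2, a3, a4, a5⟩ := (mem_SS (Or.inl rfl)).1 hv
    have hr := SS_rlt (Or.inl rfl) a1 a2 a4 a5
    have hz := (zt_mem ht hr.le a4.le (by omega : 1 ≤ q)).1
    have hz' : 1 + zt t (q,p,r,x) ≠ 0 := by positivity
    simp only [GG]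
    split_ifs
    · rw [div_self hz']; ring
    · rw [div_self hz']; ring
  set W : ℝ → ℝ := fun t => AA 1 N t (fun _ => 1) with hW
  have hW0 : ∀ t ∈ Set.Icc (0:ℝ) 1, 0 ≤ W t ∧ W t ≤ 2 * W 0 := by
    intro t ht
    have hnn : ∀ t ∈ Set.Icc (0:ℝ) 1, ∀ v ∈ SS 1 N, 0 ≤ zt t v ∧ zt t v ≤ 1 := by
      rintro t ht ⟨q, p, r, x⟩ hv
      obtain ⟨a0, a1, a2, a3, a4, a5⟩ := (mem_SS (Or.inl rfl)).1 hv
      have hr := SS_rlt (Or.inl rfl) a1 a2 a4 a5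
      exact (zt_mem ht hr.le a4.le (by omega : 1 ≤ q))
    constructor
    · apply Finset.sum_nonneg
      intro v hv
      have := (hnn t ht v hv).1
      simp only [GG]
      positivity
    · simp only [hW, AA]
      rw [Finset.mul_sum]
      apply Finset.sum_le_sum
      intro v hv
      have z1 := (hnn t ht v hv).1
      have z2 := (hnn 0 (by simp) v hv)
      obtain ⟨q, p, r, x⟩ := v
      obtain ⟨b1, b2, -⟩ := SS_facts hv
      simp only [GG]
      have ht0 := ht.1
      have e1 : 1 / (1 + zt t (q,p,r,x)) ≤ 1 := by
        rw [div_le_one (by positivity)]; linarith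
      have e2 : 1 ≤ 2 * (1 / (1 + zt 0 (q,p,r,x))) := by
        rw [mul_one_div, le_div_iff₀ (by linarith)]; linarith
      rw [← mul_div_assoc]
      apply div_le_div₀ (by linarith) (by linarith) (by positivity)
      have : (0:ℝ) ≤ p * t := by positivity
      apply pow_le_pow_left₀ (by positivity)
      linarith
  have h0m : (0:ℝ) ∈ Set.Icc (0:ℝ) 1 := by simp
  have hmain : ∀ t ∈ Set.Icc (0:ℝ) 1, |(AA 1 N t (fun x => if α < x then 1 + x else 0) - (1-α) * AA 1 N t (fun x => 1 + x)) - (c2 - (1-α)*c1) * W t| ≤ 111 := by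
    intro t ht
    have k1 := hc1 t ht
    have k2 := hc2 t ht
    have k3 : |(1-α) * (AA 1 N t (fun x => 1 + x) - c1 * W t)| ≤ 37 := by
      rw [abs_mul, abs_of_nonneg (by linarith : 0 ≤ 1-α)]
      have := abs_nonneg (AA 1 N t (fun x => 1 + x) - c1 * W t)
      have k1' : |AA 1 N t (fun x => 1 + x) - c1 * W t| ≤ 37 * 1 := k1
      nlinarith
    have k2' : |AA 1 N t (fun x => if α < x then 1 + x else 0) - c2 * W t| ≤ 37 * 2 := k2
    calc _ = |(AA 1 N t (fun x => if α < x then 1 + x else 0) - c2 * W t) - (1-α) * (AA 1 N t (fun x => 1 + x) - c1 * W t)| := by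
          congr 1; ring
      _ ≤ _ := abs_sub _ _
      _ ≤ 111 := by linarith
  have hE0 : |∑ v ∈ SS 1 N, ((if α < zt 0 v then (1:ℝ) else 0) - (1-α)) / ((v.1:ℝ) + v.2.1 * 0)^2| ≤ 6 := by
    convert E0_bound h0 h1 N using 2
    apply Finset.sum_congr rfl
    rintro ⟨q, p, r, x⟩ hv
    obtain ⟨b1, b2, -⟩ := SS_facts hv
    have : α < zt 0 (q,p,r,x) ↔ α * q < r := by
      simp only [zt, mul_zero, add_zero]
      rw [lt_div_iff₀ (by linarith)]
    simp only [this, mul_zero, add_zero]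
  rw [hE 0 h0m] at hE0
  rw [hE t ht]
  have m0 := hmain 0 h0m
  have mt := hmain t ht
  have w0 := hW0 0 h0m
  have wt := hW0 t ht
  set c := c2 - (1-α)*c1
  have q0 : |c * W 0| ≤ 117 := by
    rw [abs_le] at *
    constructor <;> linarith
  have qt : |c * W t| ≤ 234 := by
    rw [abs_mul, abs_of_nonneg wt.1]
    rw [abs_mul, abs_of_nonneg w0.1] at q0
    have := mul_le_mul_of_nonneg_left wt.2 (abs_nonneg c)
    linarith
  rw [abs_le] at *
  constructor <;> linarith

lemma bad_sum (f : ℕ → ℕ) (N : ℕ) : ∑ v ∈ (SS 1 N).filter (fun v => v.2.2.2 = f v.2.1), 1 / (v.1:ℝ)^2 ≤ 4 := by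
  classical
  calc _ ≤ ∑ v ∈ (SS 1 N).filter (fun v => v.2.2.2 = f v.2.1), 1 / ((v.2.1:ℝ) * ((v.1 / v.2.1 : ℕ):ℝ))^2 := by
        apply Finset.sum_le_sum
        rintro ⟨q, p, r, x⟩ hv
        obtain ⟨a0, a1, a2, a3, a4, a5⟩ := (mem_SS (Or.inl rfl)).1 (Finset.mem_filter.1 hv).1
        have k : 1 ≤ q / p := (Nat.one_le_div_iff (by omega)).2 a5
        have hp : 1 ≤ p := by omega
        have k' : (1:ℝ) ≤ ((q/p:ℕ):ℝ) := by exact_mod_cast k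
        have hp' : (1:ℝ) ≤ p := by exact_mod_cast hp
        have hh : (p:ℝ) * ((q/p:ℕ):ℝ) ≤ q := by exact_mod_cast Nat.mul_div_le q p
        simp only
        apply one_div_le_one_div_of_le (by positivity)
        apply pow_le_pow_left₀ (by positivity) hh
    _ = ∑ w ∈ ((SS 1 N).filter (fun v => v.2.2.2 = f v.2.1)).image (fun v => ((v.2.1, v.1 / v.2.1) : ℕ × ℕ)), 1 / (((w.1:ℕ):ℝ) * ((w.2:ℕ):ℝ))^2 := by
        rw [Finset.sum_image]
        rintro ⟨q, p, r, x⟩ hv ⟨q', p', r', x'⟩ hw h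
        simp only [Prod.mk.injEq] at h
        rw [Finset.mem_coe, Finset.mem_filter] at hv hw
        have hx := hv.2
        have hx' := hw.2
        obtain ⟨h1, h2⟩ := h
        subst h1
        simp only at hx hx'
        rw [← hx'] at hx
        subst hx
        obtain ⟨-, a1, a2, a3, a4, a5⟩ := (mem_SS (Or.inl rfl)).1 hv.1
        obtain ⟨-, b1, b2, b3, b4, b5⟩ := (mem_SS (Or.inl rfl)).1 hw.1
        have hc : IsCoprime (p:ℤ) (x:ℤ) := ⟨-r, q, by linarith⟩
        have hd : (p:ℤ) ∣ (q':ℤ) - q := by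
          apply hc.dvd_of_dvd_mul_right
          exact ⟨(r':ℤ) - r, by linarith⟩
        have hm : q ≡ q' [MOD p] := (Nat.modEq_iff_dvd).2 hd
        have hq : q = q' := by
          rw [← Nat.div_add_mod q p, ← Nat.div_add_mod q' p, h2, hm]
        exact SS_inj (Or.inl rfl) hv.1 hw.1 hq rfl
    _ ≤ 4 := by
        apply inv_sq_prod N N
        intro w hw
        obtain ⟨⟨q, p, r, x⟩, hv, rfl⟩ := Finset.mem_image.1 hw
        obtain ⟨a0, a1, a2, a3, a4, a5⟩ := (mem_SS (Or.inl rfl)).1 (Finset.mem_filter.1 hv).1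
        have k : 1 ≤ q / p := (Nat.one_le_div_iff (by omega)).2 a5
        have k2 := Nat.div_le_self q p
        simp only
        omega

lemma Ft_bound {α : ℝ} (h0 : 0 ≤ α) (h1 : α ≤ 1) (N : ℕ) {t : ℝ} (ht : t ∈ Set.Icc (0:ℝ) 1) :
    |∑ v ∈ SS 1 N, ((if (v.2.2.2:ℝ) ≤ α * v.2.1 then (1:ℝ) else 0) - α) / ((v.1:ℝ) + v.2.1 * t)^2| ≤ 349 := by
  have hE := Et_bound h0 h1 N ht
  have hb := bad_sum (fun p => ⌊α * p⌋₊ + 1) N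
  have hd : |∑ v ∈ SS 1 N, ((if (v.2.2.2:ℝ) ≤ α * v.2.1 then (1:ℝ) else 0) - α) / ((v.1:ℝ) + v.2.1 * t)^2
     + ∑ v ∈ SS 1 N, ((if α < zt t v then (1:ℝ) else 0) - (1-α)) / ((v.1:ℝ) + v.2.1 * t)^2| ≤ 4 := by
    refine le_trans ?_ hb
    rw [← Finset.sum_add_distrib, Finset.sum_filter]
    refine (Finset.abs_sum_le_sum_abs _ _).trans ?_
    apply Finset.sum_le_sum
    rintro ⟨q, p, r, x⟩ hv
    obtain ⟨b1, b2, b3, b4, b5, b6, b7, b8⟩ := SS_facts hv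
    have ht0 := ht.1
    have hpt : (0:ℝ) ≤ p * t := by positivity
    have hD : (0:ℝ) < q + p * t := by linarith
    have hzx : zt t (q,p,r,x) * p ≤ x := by
      simp only [zt]
      rw [div_mul_eq_mul_div, div_le_iff₀ hD]
      nlinarith
    have hzr : (r:ℝ) ≤ zt t (q,p,r,x) * q := by
      simp only [zt]
      rw [div_mul_eq_mul_div, le_div_iff₀ hD]
      nlinarith
    rw [← add_div]
    have hcase : ((if (x:ℝ) ≤ α * p then (1:ℝ) else 0) - α + ((if α < zt t (q,p,r,x) then (1:ℝ) else 0) - (1-α))) = 0 ∨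
       (x = ⌊α * p⌋₊ + 1 ∧ ((if (x:ℝ) ≤ α * p then (1:ℝ) else 0) - α + ((if α < zt t (q,p,r,x) then (1:ℝ) else 0) - (1-α))) = -1) := by
      split_ifs with c1 c2 c2
      · exfalso; nlinarith
      · left; ring
      · left; ring
      · right
        refine ⟨?_, by ring⟩
        push Not at c1 c2
        have hx1 : (x:ℝ) - 1 ≤ α * p := by
          have : (q:ℝ) * (x - 1) ≤ q * (α * p) := by
            have : (r:ℝ) ≤ α * q := by nlinarith
            nlinarith
          exact le_of_mul_le_mul_left this (by linarith)
        have hxn : 1 ≤ x := by exact_mod_cast b3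
        have : ⌊α * p⌋₊ = x - 1 := by
          rw [Nat.floor_eq_iff (by positivity)]
          push_cast [hxn]
          constructor <;> linarith
        omega
    simp only
    rcases hcase with h | ⟨hx, h⟩
    · rw [h]
      simp only [zero_div, abs_zero]
      split_ifs <;> positivity
    · rw [h, if_pos hx, abs_div, abs_neg, abs_one, abs_of_nonneg (sq_nonneg _)]
      apply one_div_le_one_div_of_le (by positivity)
      apply pow_le_pow_left₀ (by positivity)
      linarith
  rw [abs_le] at *
  constructor <;> linarith [hd.1, hd.2, hE.1, hE.2]

lemma int_bound {α : ℝ} (h0 : 0 ≤ α) (h1 : α ≤ 1) (N : ℕ) :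
    |∑ v ∈ SS 1 N, ((if (v.2.2.2:ℝ) ≤ α * v.2.1 then (1:ℝ) else 0) - α) / ((v.1:ℝ) * (v.2.1 + v.1))| ≤ 349 := by
  set a : ℕ × ℕ × ℕ × ℕ → ℝ := fun v => ((if (v.2.2.2:ℝ) ≤ α * v.2.1 then (1:ℝ) else 0) - α) with ha
  have := norm_image_sub_le_of_norm_deriv_le_segment_01' (E := ℝ)
    (f := fun t => ∑ v ∈ SS 1 N, a v * (t / ((v.1:ℝ) * (v.1 + v.2.1 * t))))
    (f' := fun t => ∑ v ∈ SS 1 N, a v / ((v.1:ℝ) + v.2.1 * t)^2) (C := 349) ?_ ?_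
  · simp only [Real.norm_eq_abs, mul_one, zero_div, mul_zero, Finset.sum_const_zero, sub_zero] at this
    convert this using 2
    apply Finset.sum_congr rfl
    intro v hv
    rw [add_comm]
    ring
  · intro t ht
    apply HasDerivWithinAt.fun_sum
    rintro ⟨q, p, r, x⟩ hv
    obtain ⟨b1, b2, -⟩ := SS_facts hv
    have ht0 := ht.1
    have hpt : (0:ℝ) ≤ p * t := by positivity
    have hD : (0:ℝ) < q + p * t := by linarith
    simp only
    rw [div_eq_mul_one_div]
    apply HasDerivWithinAt.const_mul
    apply HasDerivAt.hasDerivWithinAt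
    have d1 : HasDerivAt (fun t : ℝ => (q:ℝ) * (q + p * t)) ((q:ℝ) * (p * 1)) t :=
      (((hasDerivAt_id t).const_mul (p:ℝ)).const_add (q:ℝ)).const_mul (q:ℝ)
    have d2 := (hasDerivAt_id t).div d1 (by positivity)
    have hq0 : (q:ℝ) ≠ 0 := by linarith
    have e : ((1:ℝ) * (↑q * (↑q + ↑p * t)) - id t * (↑q * (↑p * 1))) / (↑q * (↑q + ↑p * t)) ^ 2 = 1 / ((q:ℝ) + p * t)^2 := by
      simp only [id]
      field_simp
      ring
    rw [e] at d2
    exact d2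
  · intro t ht
    exact Ft_bound h0 h1 N ⟨ht.1, ht.2.le⟩

lemma exists_of_coprime_p {q p : ℕ} (hp : 2 ≤ p) (hpq : p ≤ q) (hc : Nat.gcd p q = 1) :
    ∃ r x : ℕ, (q * x : ℤ) - p * r = 1 ∧ 1 ≤ x ∧ x ≤ r ∧ x < p ∧ p ≤ q := by
  have hc' : Nat.Coprime q p := by rw [Nat.coprime_comm]; exact hc
  obtain ⟨x, hx, hx1⟩ := Nat.exists_mul_mod_eq_one_of_coprime (n := q) (k := p) hc' (by omega)
  have h1 := Nat.div_add_mod (q * x) p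
  rw [hx1] at h1
  generalize q * x / p = r at h1
  have hlt : p < q := by
    rcases hpq.lt_or_eq with h | h
    · exact h
    · subst h; rw [Nat.gcd_self] at hc; omega
  have hx0 : 1 ≤ x := by
    rcases Nat.eq_zero_or_pos x with h | h
    · subst h; simp at h1
    · exact h
  refine ⟨r, x, ?_, hx0, ?_, hx, hpq⟩
  · have : (p:ℤ) * r + 1 = q * x := by exact_mod_cast h1
    linarith
  · by_contra hh
    push Not at hh
    have a1 : p * (r + 1) ≤ p * x := Nat.mul_le_mul_left _ hh
    have a2 : (p+1) * x ≤ q * x := Nat.mul_le_mul_right _ hlt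
    nlinarith

lemma SS_log : ∃ C : ℝ, 0 < C ∧ ∀ N : ℕ, 1 ≤ N →
    |∑ v ∈ SS 1 N, 1 / ((v.1:ℝ) * (v.2.1 + v.1)) - Real.log 2/(Real.pi^2/6)*Real.log N| ≤ C := by
  classical
  obtain ⟨C, hC, h⟩ := coprime_sum
  refine ⟨C + 2, by linarith, fun N hN => ?_⟩
  have hf := h N hN
  rw [Finset.sum_sigma', ← Finset.sum_filter] at hf
  set T := ((Icc 1 N).sigma (fun q => Icc 1 q)).filter (fun w => Nat.gcd w.2 w.1 = 1) with hT
  set g : (Σ _ : ℕ, ℕ) → ℝ := fun w => 1 / ((w.1:ℝ)*(w.2+w.1)) with hg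
  change |∑ w ∈ T, g w - _| ≤ C at hf
  let e : ℕ × ℕ × ℕ × ℕ → (Σ _ : ℕ, ℕ) := fun v => ⟨v.1, v.2.1⟩
  have hS : ∑ v ∈ SS 1 N, 1 / ((v.1:ℝ) * (v.2.1 + v.1))
      = ∑ w ∈ (SS 1 N).image e, g w := by
    rw [Finset.sum_image]
    intro v hv w hw h
    simp only [e, Sigma.mk.injEq, heq_eq_eq] at h
    exact SS_inj (Or.inl rfl) hv hw h.1 h.2
  have hsub : (SS 1 N).image e ⊆ T := by
    intro w hw
    obtain ⟨⟨q, p, r, x⟩, hv, rfl⟩ := Finset.mem_image.1 hw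
    obtain ⟨a0, a1, a2, a3, a4, a5⟩ := (mem_SS (Or.inl rfl)).1 hv
    have hc : IsCoprime (p:ℤ) (q:ℤ) := ⟨-r, x, by linarith⟩
    simp only [hT, e, Finset.mem_filter, Finset.mem_sigma, Finset.mem_Icc]
    exact ⟨⟨by omega, by omega⟩, Nat.isCoprime_iff_coprime.1 hc⟩
  have hsd := Finset.sum_sdiff (f := g) hsub
  have hnn : 0 ≤ ∑ w ∈ T \ (SS 1 N).image e, g w := by
    apply Finset.sum_nonneg
    intro w _
    simp only [hg]; positivity
  have hrest : ∑ w ∈ T \ (SS 1 N).image e, g w ≤ 2 := by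
    have key : ∀ w ∈ T \ (SS 1 N).image e, 1 ≤ w.1 ∧ w.1 ≤ N ∧ w.2 = 1 := by
      rintro ⟨q, p⟩ hw
      rw [Finset.mem_sdiff] at hw
      obtain ⟨hw1, hw2⟩ := hw
      simp only [hT, Finset.mem_filter, Finset.mem_sigma, Finset.mem_Icc] at hw1
      obtain ⟨⟨⟨c1, c2⟩, c3, c4⟩, c5⟩ := hw1
      refine ⟨c1, c2, ?_⟩
      by_contra hne
      simp only at hne
      obtain ⟨r, x, d1, d2, d3, d4, d5⟩ := exists_of_coprime_p (by omega) c4 c5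
      exact hw2 (Finset.mem_image.2 ⟨(q,p,r,x), (mem_SS (Or.inl rfl)).2 ⟨c2, d1, d2, d3, d4, d5⟩, rfl⟩)
    calc ∑ w ∈ T \ (SS 1 N).image e, g w 
      _ ≤ ∑ w ∈ T \ (SS 1 N).image e, 1 / (w.1:ℝ)^2 := by
          apply Finset.sum_le_sum
          intro w hw
          have := (key w hw).1
          have h1 : (1:ℝ) ≤ w.1 := by exact_mod_cast this
          apply one_div_le_one_div_of_le (by positivity)
          have : (0:ℝ) ≤ w.2 := by positivity
          nlinarith
      _ = ∑ a ∈ (T \ (SS 1 N).image e).image (fun w => (w.1:ℕ)), 1 / ((a:ℕ):ℝ)^2 := by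
          rw [Finset.sum_image]
          intro v hv w hw h
          have k1 := (key v hv).2.2
          have k2 := (key w hw).2.2
          exact Sigma.ext h (heq_of_eq (k1.trans k2.symm))
      _ ≤ ∑ a ∈ Icc 1 N, 1 / (a:ℝ)^2 := by
          apply Finset.sum_le_sum_of_subset_of_nonneg
          · intro a ha
            obtain ⟨w, hw, rfl⟩ := Finset.mem_image.1 ha
            have := key w hw
            exact Finset.mem_Icc.2 ⟨this.1, this.2.1⟩
          · intros; positivity
      _ ≤ 2 := inv_sq_sum' N
  rw [hS]
  rw [abs_le] at *
  constructor <;> linarith [hf.1, hf.2]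

def LL (M q p : ℕ) : Finset (ℕ × ℕ) :=
  ((range (M+1)) ×ˢ (range (M+1))).filter fun w => 1 ≤ w.2 ∧ w.2 < w.1 ∧ w.1 * q + w.2 * p ≤ M

lemma mem_LL {M q p n k : ℕ} (hq : 1 ≤ q) (hp : 1 ≤ p) :
    (n, k) ∈ LL M q p ↔ 1 ≤ k ∧ k < n ∧ n * q + k * p ≤ M := by
  simp only [LL, mem_filter, mem_product, mem_range]
  constructor
  · exact fun h => h.2
  · intro h
    have : n ≤ n * q := Nat.le_mul_of_pos_right _ hq
    have : k ≤ k * p := Nat.le_mul_of_pos_right _ hp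
    exact ⟨⟨by omega, by omega⟩, h⟩

lemma LL_card {M q p : ℕ} (hq : 1 ≤ q) (hp : 1 ≤ p) :
    (LL M q p).card = ∑ k ∈ Icc 1 (M / (p + q)), ((M - k * p) / q - k) := by
  classical
  have : LL M q p = ((Icc 1 (M / (p+q))).sigma (fun k => Ioc k ((M - k * p)/q))).image (fun s => ((s.2, s.1) : ℕ × ℕ)) := by
    ext ⟨n, k⟩
    rw [mem_LL hq hp]
    simp only [mem_image, mem_sigma, mem_Icc, mem_Ioc, Prod.mk.injEq]
    constructor
    · rintro ⟨h1, h2, h3⟩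
      refine ⟨⟨k, n⟩, ⟨⟨h1, ?_⟩, h2, ?_⟩, rfl, rfl⟩
      · rw [Nat.le_div_iff_mul_le (by omega)]
        nlinarith
      · simp only
        rw [Nat.le_div_iff_mul_le (by omega)]
        omega
    · rintro ⟨⟨k', n'⟩, ⟨⟨h1, h2⟩, h3, h4⟩, e1, e2⟩
      simp only at e1 e2 h1 h2 h3 h4
      subst e1 e2
      rw [Nat.le_div_iff_mul_le (by omega)] at h2 h4
      have h5 : k' * (p + q) = k' * p + k' * q := by ring
      exact ⟨h1, h3, by omega⟩
  rw [this, card_image_of_injOn, card_sigma]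
  · simp
  · rintro ⟨a, b⟩ _ ⟨c, d⟩ _ h
    simp only [Prod.mk.injEq] at h
    obtain ⟨rfl, rfl⟩ := h
    rfl

lemma LL_est {M q p : ℕ} (hq : 1 ≤ q) (hp : 1 ≤ p) :
    |((LL M q p).card : ℝ) - (M:ℝ)^2 / (2 * (q * (p + q)))| ≤ 2 * (M:ℝ) := by
  rw [LL_card hq hp]
  have hM := Nat.div_add_mod M (p+q)
  have hρ := Nat.mod_lt M (show p + q > 0 by omega)
  set K := M / (p+q) with hK
  set ρ := M % (p+q)
  have hqR : (1:ℝ) ≤ q := by exact_mod_cast hq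
  have hpR : (1:ℝ) ≤ p := by exact_mod_cast hp
  have hMR : ((p:ℝ)+q) * K + ρ = M := by exact_mod_cast hM
  have hρR : (ρ:ℝ) ≤ p + q := by exact_mod_cast hρ.le
  have hρ0 : (0:ℝ) ≤ ρ := by positivity
  have hK0 : (0:ℝ) ≤ K := by positivity
  have hterm : ∀ k ∈ Icc 1 K, |((((M - k * p) / q - k : ℕ)):ℝ) - ((M:ℝ) - k * (p+q)) / q| ≤ 1 := by
    intro k hk
    rw [mem_Icc] at hk
    have h2 : k * (p+q) ≤ M := (Nat.le_div_iff_mul_le (by omega)).1 hk.2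
    have h5 : k * (p + q) = k * p + k * q := by ring
    have h3 : k ≤ (M - k*p)/q := by
      rw [Nat.le_div_iff_mul_le (by omega)]; omega
    have h4 : k * p ≤ M := by omega
    rw [Nat.cast_sub h3]
    have e : ((M:ℝ) - k * (p+q)) / q = ((M - k * p : ℕ):ℝ)/q - k := by
      rw [Nat.cast_sub h4]; push_cast; field_simp; ring
    rw [e]
    have f1 := Nat.cast_div_le (α := ℝ) (m := M - k*p) (n := q)
    have f2 : ((M - k*p:ℕ):ℝ)/q < (((M - k*p)/q:ℕ):ℝ) + 1 := by
      rw [div_lt_iff₀ (by linarith)]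
      have := Nat.lt_mul_div_succ (M - k*p) (show 0 < q by omega)
      have t : ((M - k*p:ℕ):ℝ) < q * (((M - k*p)/q:ℕ) + 1 : ℝ) := by exact_mod_cast this
      linarith
    rw [abs_le]; constructor <;> linarith
  have hsum : ∑ k ∈ Icc 1 K, ((M:ℝ) - k * (p+q)) / q = (K * M - (p+q) * (K * (K+1) / 2)) / q := by
    have : ∀ K : ℕ, ∑ k ∈ Icc 1 K, ((M:ℝ) - k * (p+q)) / q = (K * M - (p+q) * (K * (K+1) / 2)) / q := by
      intro K
      induction K with
      | zero => simp
      | succ n ih =>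
        rw [Finset.sum_Icc_succ_top (by omega), ih, ← add_div]
        push_cast
        congr 1
        ring
    exact this K
  have h1 : |((∑ k ∈ Icc 1 K, ((M - k * p) / q - k) : ℕ):ℝ) - ∑ k ∈ Icc 1 K, ((M:ℝ) - k * (p+q)) / q| ≤ K := by
    rw [Nat.cast_sum, ← Finset.sum_sub_distrib]
    refine (Finset.abs_sum_le_sum_abs _ _).trans ((Finset.sum_le_sum hterm).trans ?_)
    simp
  rw [hsum] at h1
  have hs : (0:ℝ) < p + q := by linarith
  have h2 : ((K:ℝ) * M - (p+q) * (K * (K+1) / 2)) / q - (M:ℝ)^2 / (2 * (q * (p + q))) = -((((p:ℝ)+q) * K / 2 + ρ * (ρ / (p+q)) / 2) / q) := by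
    rw [← hMR]; field_simp; ring
  have h3 : (ρ:ℝ) * (ρ / (p+q)) ≤ ρ := by
    have : (ρ:ℝ) / (p+q) ≤ 1 := (div_le_one hs).2 hρR
    nlinarith
  have h4 : 0 ≤ ((((p:ℝ)+q) * K / 2 + ρ * (ρ / (p+q)) / 2) / q) := by positivity
  have h5 : ((((p:ℝ)+q) * K / 2 + ρ * (ρ / (p+q)) / 2) / q) ≤ M := by
    refine (div_le_self (by positivity) hqR).trans ?_
    have : 0 ≤ ((p:ℝ)+q) * K := by positivity
    linarith
  have h6 : (K:ℝ) ≤ M := by nlinarith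
  rw [abs_le] at *
  constructor <;> linarith [h1.1, h1.2]

lemma modInv_eq {q p r x : ℕ} (h : (q * x : ℤ) - p * r = 1) (hx : 1 ≤ x) (hxp : x < p) : modInv p q = x := by
  have h1 : q * x = p * r + 1 := by
    have : (q * x : ℤ) = p * r + 1 := by linarith
    exact_mod_cast this
  have h2 : ((q:ZMod p)) * (x : ZMod p) = 1 := by
    have := congrArg (Nat.cast : ℕ → ZMod p) h1
    push_cast at this
    rw [this]; simp
  have h3 : (q:ZMod p)⁻¹ = (x : ZMod p) := ZMod.inv_eq_of_mul_eq_one p _ _ h2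
  unfold modInv
  rw [h3, ZMod.val_natCast_of_lt hxp, if_neg (by omega)]

lemma count_eq (α : ℚ) (U : ℝ) (hU : 2 ≤ U) :
    {x : ℕ × ℕ × ℕ × ℕ | Case1 α U x.1 x.2.1 x.2.2.1 x.2.2.2}.ncard =
      ∑ v ∈ (SS 1 ⌊U⌋₊).filter (fun v => (v.2.2.2:ℝ) ≤ (α:ℝ) * v.2.1), (LL ⌊U^2⌋₊ v.1 v.2.1).card := by
  classical
  set B := ((SS 1 ⌊U⌋₊).filter (fun v => (v.2.2.2:ℝ) ≤ (α:ℝ) * v.2.1)).sigma (fun v => LL ⌊U^2⌋₊ v.1 v.2.1) with hB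
  let f : (Σ _ : ℕ × ℕ × ℕ × ℕ, ℕ × ℕ) → ℕ × ℕ × ℕ × ℕ := fun s => (s.1.2.1, s.1.1, s.2.1, s.2.2)
  have hset : {x : ℕ × ℕ × ℕ × ℕ | Case1 α U x.1 x.2.1 x.2.2.1 x.2.2.2} = ↑(B.image f) := by
    ext ⟨p, q, n, k⟩
    simp only [Set.mem_ofPred_eq, Finset.mem_coe, Finset.mem_image]
    constructor
    · rintro ⟨h1, h2, h3, h4, h5, h6, h7, h8, h9⟩
      obtain ⟨r, x, d1, d2, d3, d4, d5⟩ := exists_of_coprime_p h2 h3 h1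
      rw [modInv_eq d1 d2 d4] at h9
      refine ⟨⟨(q,p,r,x),(n,k)⟩, ?_, rfl⟩
      rw [hB, Finset.mem_sigma, Finset.mem_filter]
      refine ⟨⟨(mem_SS (Or.inl rfl)).2 ⟨Nat.le_floor h4, d1, d2, d3, d4, d5⟩, h9⟩, ?_⟩
      exact (mem_LL (q := q) (p := p) (by omega) (by omega)).2 ⟨h7, h8, Nat.le_floor h6⟩
    · rintro ⟨⟨⟨q', p', r, x⟩, n', k'⟩, hs, he⟩
      simp only [f, Prod.mk.injEq] at he
      obtain ⟨rfl, rfl, rfl, rfl⟩ := he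
      rw [hB, Finset.mem_sigma, Finset.mem_filter] at hs
      obtain ⟨⟨hs1, hs2⟩, hs3⟩ := hs
      obtain ⟨a0, a1, a2, a3, a4, a5⟩ := (mem_SS (Or.inl rfl)).1 hs1
      obtain ⟨b1, b2, b3⟩ := (mem_LL (q := q') (p := p') (by omega) (by omega)).1 hs3
      have hc : IsCoprime (p':ℤ) (q':ℤ) := ⟨-r, x, by linarith⟩
      refine ⟨Nat.isCoprime_iff_coprime.1 hc, by omega, a5, (Nat.le_floor_iff (by linarith)).1 a0, ?_,
        (Nat.le_floor_iff (by positivity)).1 b3, b1, b2, ?_⟩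
      · have : n' ≤ n' * q' := Nat.le_mul_of_pos_right _ (by omega)
        omega
      · rw [modInv_eq a1 a2 a4]
        exact hs2
  rw [hset, Set.ncard_coe_finset, Finset.card_image_of_injOn, Finset.card_sigma]
  rintro ⟨v, n, k⟩ hv ⟨w, n', k'⟩ hw h
  simp only [f, Prod.mk.injEq] at h
  rw [Finset.mem_coe, hB, Finset.mem_sigma, Finset.mem_filter] at hv hw
  have := SS_inj (Or.inl rfl) hv.1.1 hw.1.1 h.2.1 h.1
  simp only at this
  subst this
  obtain ⟨-, -, rfl, rfl⟩ := h
  rfl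

lemma SS_card (N : ℕ) : (SS 1 N).card ≤ N ^ 2 := by
  classical
  have : (SS 1 N).card ≤ (Icc 1 N ×ˢ Icc 1 N).card := by
    apply Finset.card_le_card_of_injOn (fun v => ((v.1, v.2.1) : ℕ × ℕ))
    · rintro ⟨q, p, r, x⟩ hv
      obtain ⟨a0, a1, a2, a3, a4, a5⟩ := (mem_SS (Or.inl rfl)).1 hv
      simp only [Finset.coe_product, Set.mem_prod, Finset.mem_coe, Finset.mem_Icc]
      omega
    · intro v hv w hw h
      simp only [Prod.mk.injEq] at h
      exact SS_inj (Or.inl rfl) hv hw h.1 h.2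
  rw [Finset.card_product, Nat.card_Icc] at this
  simpa [sq] using this

lemma main_est : ∃ C : ℝ, 0 < C ∧ ∀ α : ℝ, 0 ≤ α → α ≤ 1 → ∀ N : ℕ, 1 ≤ N → ∀ M : ℕ,
    |((∑ v ∈ (SS 1 N).filter (fun v => (v.2.2.2:ℝ) ≤ α * v.2.1), (LL M v.1 v.2.1).card : ℕ):ℝ)
      - (M:ℝ)^2 / 2 * (α * (Real.log 2/(Real.pi^2/6)*Real.log N))| ≤ C * (M:ℝ)^2 + 2 * (M:ℝ) * (N:ℝ)^2 := by
  obtain ⟨C, hC, h⟩ := SS_log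
  refine ⟨349 + C, by linarith, fun α h0 h1 N hN M => ?_⟩
  have hl := h N hN
  have hi := int_bound h0 h1 N
  set X := ∑ v ∈ (SS 1 N).filter (fun v => (v.2.2.2:ℝ) ≤ α * v.2.1), 1 / ((v.1:ℝ) * (v.2.1 + v.1)) with hX
  set Y := ∑ v ∈ SS 1 N, 1 / ((v.1:ℝ) * (v.2.1 + v.1)) with hY
  have hi2 : ∑ v ∈ SS 1 N, ((if (v.2.2.2:ℝ) ≤ α * v.2.1 then (1:ℝ) else 0) - α) / ((v.1:ℝ) * (v.2.1 + v.1)) = X - α * Y := by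
    rw [hX, hY, Finset.sum_filter, Finset.mul_sum, ← Finset.sum_sub_distrib]
    apply Finset.sum_congr rfl
    intro v _
    split_ifs <;> ring
  rw [hi2] at hi
  have hR : |((∑ v ∈ (SS 1 N).filter (fun v => (v.2.2.2:ℝ) ≤ α * v.2.1), (LL M v.1 v.2.1).card : ℕ):ℝ) - (M:ℝ)^2 / 2 * X| ≤ 2 * (M:ℝ) * (N:ℝ)^2 := by
    rw [hX, Nat.cast_sum, Finset.mul_sum, ← Finset.sum_sub_distrib]
    refine (Finset.abs_sum_le_sum_abs _ _).trans ?_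
    calc _ ≤ ∑ v ∈ (SS 1 N).filter (fun v => (v.2.2.2:ℝ) ≤ α * v.2.1), 2 * (M:ℝ) := by
          apply Finset.sum_le_sum
          rintro ⟨q, p, r, x⟩ hv
          obtain ⟨a0, a1, a2, a3, a4, a5⟩ := (mem_SS (Or.inl rfl)).1 (Finset.mem_filter.1 hv).1
          have := LL_est (M := M) (q := q) (p := p) (by omega) (by omega)
          have e : (M:ℝ)^2 / 2 * (1 / ((q:ℝ) * (p + q))) = (M:ℝ)^2 / (2 * (q * (p + q))) := by
            rw [div_mul_div_comm, mul_one]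
          simp only
          rw [e]
          exact this
      _ ≤ _ := by
          rw [Finset.sum_const, nsmul_eq_mul, mul_comm]
          apply mul_le_mul_of_nonneg_left _ (by positivity)
          have := (Finset.card_filter_le (SS 1 N) (fun v => (v.2.2.2:ℝ) ≤ α * v.2.1)).trans (SS_card N)
          exact_mod_cast this
  set Lg := Real.log 2/(Real.pi^2/6)*Real.log N
  have hXL : |X - α * Lg| ≤ 349 + C := by
    have k : |α * (Y - Lg)| ≤ C := by
      rw [abs_mul, abs_of_nonneg h0]
      have := abs_nonneg (Y - Lg)
      nlinarith
    rw [abs_le] at *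
    constructor <;> linarith [k.1, k.2, hi.1, hi.2]
  have hXL2 : |(M:ℝ)^2 / 2 * (X - α * Lg)| ≤ (349 + C) * (M:ℝ)^2 := by
    rw [abs_mul, abs_of_nonneg (by positivity)]
    have : (M:ℝ)^2 / 2 * |X - α * Lg| ≤ (M:ℝ)^2 / 2 * (349 + C) := mul_le_mul_of_nonneg_left hXL (by positivity)
    have : 0 ≤ (M:ℝ)^2 * (349 + C) := by positivity
    linarith
  rw [abs_le] at *
  constructor <;> linarith [hR.1, hR.2, hXL2.1, hXL2.2]

end Helpers

theorem case1_count :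
    ∃ C : ℝ, 0 < C ∧ ∀ α : ℚ, 0 < α → α ≤ 1 → ∀ U : ℝ, 2 ≤ U →
      |(({x : ℕ × ℕ × ℕ × ℕ | Case1 α U x.1 x.2.1 x.2.2.1 x.2.2.2}.ncard : ℝ))
        - (α : ℝ) * Real.log 2 / (2 * (Real.pi^2/6)) * U^4 * Real.log U|
      ≤ C * U^4 := by
  obtain ⟨C, hC, h⟩ := main_est
  set L := Real.log 2/(Real.pi^2/6) with hL
  have hL0 : 0 < L := by
    have := Real.log_pos (show (1:ℝ) < 2 by norm_num)
    positivity
  refine ⟨C + 2 + 2 * L, by linarith, fun α ha0 ha1 U hU => ?_⟩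
  rw [count_eq α U hU]
  have a0 : (0:ℝ) ≤ α := by exact_mod_cast ha0.le
  have a1 : (α:ℝ) ≤ 1 := by exact_mod_cast ha1
  have hU0 : (0:ℝ) ≤ U := by linarith
  have hN2 : 2 ≤ ⌊U⌋₊ := Nat.le_floor (by exact_mod_cast hU)
  have hm := h α a0 a1 ⌊U⌋₊ (by omega) ⌊U^2⌋₊
  have n1 := Nat.floor_le hU0
  have n2 := Nat.lt_floor_add_one U
  have m1 := Nat.floor_le (show 0 ≤ U^2 by positivity)
  have m2 := Nat.lt_floor_add_one (U^2)
  have n0 : (2:ℝ) ≤ (⌊U⌋₊:ℝ) := by exact_mod_cast hN2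
  have m0 : (0:ℝ) ≤ (⌊U^2⌋₊:ℝ) := by positivity
  set R := ((∑ v ∈ (SS 1 ⌊U⌋₊).filter (fun v => (v.2.2.2:ℝ) ≤ (α:ℝ) * v.2.1), (LL ⌊U^2⌋₊ v.1 v.2.1).card : ℕ):ℝ)
  generalize (⌊U^2⌋₊:ℝ) = M at *
  generalize (⌊U⌋₊:ℝ) = N at *
  have lN : Real.log N ≤ Real.log U := Real.log_le_log (by linarith) n1
  have lN2 : Real.log U ≤ Real.log N + 1 := by
    have : Real.log U ≤ Real.log (2 * N) := Real.log_le_log (by linarith) (by linarith)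
    rw [Real.log_mul (by norm_num) (by linarith)] at this
    have := Real.log_two_lt_d9
    linarith
  have lN0 : 0 ≤ Real.log N := Real.log_nonneg (by linarith)
  have lU : Real.log U ≤ U := (Real.log_le_sub_one_of_pos (by linarith)).trans (by linarith)
  have hMU : M^2 ≤ U^4 := by
    calc M^2 ≤ (U^2)^2 := pow_le_pow_left₀ m0 m1 2
      _ = U^4 := by ring
  have hMU2 : U^4 - M^2 ≤ 2 * U^2 := by nlinarith
  have hMN : 2 * M * N^2 ≤ 2 * U^4 := by
    have : M * N^2 ≤ U^2 * U^2 := mul_le_mul m1 (pow_le_pow_left₀ (by linarith) n1 2) (by positivity) (by positivity)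
    nlinarith
  have hCM : C * M^2 ≤ C * U^4 := mul_le_mul_of_nonneg_left hMU hC.le
  have hdiff0 : 0 ≤ U^4 * Real.log U - M^2 * Real.log N := by
    have : M^2 * Real.log N ≤ U^4 * Real.log U := mul_le_mul hMU lN lN0 (by positivity)
    linarith
  have hdiff1 : U^4 * Real.log U - M^2 * Real.log N ≤ 4 * U^4 := by
    have e : U^4 * Real.log U - M^2 * Real.log N = (U^4 - M^2) * Real.log U + M^2 * (Real.log U - Real.log N) := by ring
    have e1 : (U^4 - M^2) * Real.log U ≤ 2 * U^2 * U := mul_le_mul hMU2 lU (by linarith) (by positivity)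
    have e2 : M^2 * (Real.log U - Real.log N) ≤ U^4 * 1 := mul_le_mul hMU (by linarith) (by linarith) (by positivity)
    have e3 : U^3 * 1 ≤ U^3 * U := mul_le_mul_of_nonneg_left (by linarith) (by positivity)
    have e4 : 0 ≤ U^4 := by positivity
    nlinarith
  have hαL : 0 ≤ (α:ℝ) * L / 2 ∧ (α:ℝ) * L / 2 ≤ L / 2 := by
    constructor
    · positivity
    · nlinarith
  have hfin0 : 0 ≤ (α:ℝ) * L / 2 * (U^4 * Real.log U - M^2 * Real.log N) := mul_nonneg hαL.1 hdiff0
  have hfin1 : (α:ℝ) * L / 2 * (U^4 * Real.log U - M^2 * Real.log N) ≤ L / 2 * (4 * U^4) :=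
    mul_le_mul hαL.2 hdiff1 hdiff0 (by linarith)
  have hrw : (α : ℝ) * Real.log 2 / (2 * (Real.pi^2/6)) * U^4 * Real.log U
     = M^2 / 2 * (α * (L * Real.log N)) + (α:ℝ) * L / 2 * (U^4 * Real.log U - M^2 * Real.log N) := by
    rw [hL]
    have := Real.pi_ne_zero
    field_simp
    ring
  rw [hrw]
  have hU4 : 0 ≤ L * U^4 := by positivity
  rw [abs_le] at *
  constructor <;> linarith [hm.1, hm.2]
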